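/- arXiv:1205.2498 — 5 statements merged into one kernel-verified Lean document; each statement's English description precedes it below -/
import Mathlib

section
/- For every finite group G, the intersection of all maximal nilpotent subgroups of G is equal to the hypercenter Z_∞(G) of G. -/
/-- The hypercenter `Z_∞(G)` of a finite group `G`: the final (stabilizing) term of the
upper central series of `G` (for a finite group the series stabilizes at index `Nat.card G`). -/
noncomputable def hypercenter (G : Type*) [Group G] : Subgroup G :=
  upperCentralSeries G (Nat.card G)

/-- `U` is a maximal nilpotent subgroup of `G`: `U` is nilpotent, and `U = V` whenever
`U ≤ V ≤ G` with `V` nilpotent. -/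
def IsMaximalNilpotent {G : Type*} [Group G] (U : Subgroup G) : Prop :=
  Group.IsNilpotent U ∧ ∀ V : Subgroup G, U ≤ V → Group.IsNilpotent V → U = V

open scoped commutatorElement

theorem upperCentralSeries_le_hypercenter (G : Type*) [Group G] [Finite G] (n : ℕ) :
    Subgroup.upperCentralSeries G n ≤ hypercenter G := by
  change _ ≤ Subgroup.upperCentralSeries G (Nat.card G)
  obtain ⟨i, hi, h⟩ : ∃ i ≤ Nat.card G,
      Subgroup.upperCentralSeries G i = Subgroup.upperCentralSeries G (i + 1) := by
    by_contra! hne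
    have hcard : ∀ i ≤ Nat.card G + 1, i < Nat.card (Subgroup.upperCentralSeries G i) := by
      intro i
      induction i with
      | zero => exact fun _ => Nat.card_pos
      | succ i ih =>
        intro hi
        have hlt : Subgroup.upperCentralSeries G i < Subgroup.upperCentralSeries G (i + 1) :=
          lt_of_le_of_ne (Subgroup.upperCentralSeries_mono G i.le_succ) (hne i (by lia))
        have := Set.Finite.card_lt_card
          (Set.toFinite (Subgroup.upperCentralSeries G (i + 1) : Set G)) hlt
        exact lt_of_le_of_lt (ih (by lia)) this
    have := hcard (Nat.card G + 1) le_rfl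
    have := (Subgroup.upperCentralSeries G (Nat.card G + 1)).card_le_card_group
    lia
  rw [← Subgroup.upperCentralSeries.eq_ge_of_eq_succ hi h]
  rcases le_total n i with hn | hn
  · exact Subgroup.upperCentralSeries_mono G hn
  · exact (Subgroup.upperCentralSeries.eq_ge_of_eq_succ hn h).ge

theorem IsMaximalNilpotent.map_mulEquiv {G H : Type*} [Group G] [Group H] {U : Subgroup G}
    (hU : IsMaximalNilpotent U) (e : G ≃* H) : IsMaximalNilpotent (U.map (e : G →* H)) := by
  refine ⟨(Group.isNilpotent_congr (e.subgroupMap U)).mp hU.1, fun V hUV hV => ?_⟩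
  have hV' : Group.IsNilpotent (V.map (e.symm : H →* G)) :=
    (Group.isNilpotent_congr (e.symm.subgroupMap V)).mp hV
  have hle : U ≤ V.map (e.symm : H →* G) := by
    rw [← Subgroup.map_le_map_iff_of_injective (f := (e : G →* H)) e.injective,
      Subgroup.map_map]
    simpa using hUV
  rw [hU.2 _ hle hV', Subgroup.map_map]
  simp

theorem exists_isMaximalNilpotent_ge {G : Type*} [Group G] [Finite G] (H : Subgroup G)
    (hH : Group.IsNilpotent H) : ∃ U : Subgroup G, H ≤ U ∧ IsMaximalNilpotent U := by
  obtain ⟨U, hHU, hU⟩ :=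
    Finite.exists_le_maximal (p := fun U : Subgroup G => Group.IsNilpotent U) hH
  exact ⟨U, hHU, hU.prop, fun V hUV hV => hU.eq_of_le hV hUV⟩

theorem isNilpotent_sup_upperCentralSeries {G : Type*} [Group G] (U : Subgroup G)
    (hU : Group.IsNilpotent U) (n : ℕ) :
    Group.IsNilpotent (U ⊔ Subgroup.upperCentralSeries G n : Subgroup G) := by
  set Z := Subgroup.upperCentralSeries G n
  obtain ⟨c, hc⟩ := (Subgroup.isNilpotent_iff_lowerCentralSeries U).mp hU
  have hmap : (U ⊔ Z).map (QuotientGroup.mk' Z) = U.map (QuotientGroup.mk' Z) := by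
    simp [Subgroup.map_sup]
  have hstart : (U ⊔ Z).lowerCentralSeries c ≤ Z := by
    have h : ((U ⊔ Z).lowerCentralSeries c).map (QuotientGroup.mk' Z) = ⊥ := by
      rw [Subgroup.map_lowerCentralSeries, hmap, ← Subgroup.map_lowerCentralSeries, hc,
        Subgroup.map_bot]
    simpa [Subgroup.map_eq_bot_iff] using h
  have hdescend : ∀ k ≤ n,
      (U ⊔ Z).lowerCentralSeries (c + k) ≤ Subgroup.upperCentralSeries G (n - k) := by
    intro k
    induction k with
    | zero => simpa using hstart
    | succ k ih =>
      intro hk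
      have hsub : n - k = n - (k + 1) + 1 := by lia
      rw [← add_assoc, Subgroup.lowerCentralSeries_succ]
      refine (Subgroup.commutator_mono (ih (by lia)) le_top).trans ?_
      rw [hsub]
      exact Subgroup.commutator_upperCentralSeries_top_le G _
  refine Subgroup.isNilpotent_of_lowerCentralSeries_eq_bot (n := c + n) ?_
  simpa using hdescend n le_rfl

theorem hypercenter_le_of_isMaximalNilpotent {G : Type*} [Group G] {U : Subgroup G}
    (hU : IsMaximalNilpotent U) : hypercenter G ≤ U := by
  have h := hU.2 (U ⊔ hypercenter G) le_sup_left (isNilpotent_sup_upperCentralSeries U hU.1 _)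
  exact le_sup_right.trans h.ge

theorem Subgroup.eq_top_of_forall_exists_sylow_le {G : Type*} [Group G] [Finite G]
    (H : Subgroup G) (h : ∀ p : ℕ, p.Prime → ∃ P : Sylow p G, (P : Subgroup G) ≤ H) : H = ⊤ := by
  refine Subgroup.eq_top_of_card_eq H (Nat.dvd_antisymm H.card_subgroup_dvd_card ?_)
  refine (Nat.dvd_iff_prime_pow_dvd_dvd _ _).mpr fun p k hp hk => ?_
  obtain ⟨P, hP⟩ := h p hp
  have : Fact p.Prime := ⟨hp⟩
  exact (P.pow_dvd_card_of_pow_dvd_card hk).trans (Subgroup.card_dvd_of_le hP)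

theorem Group.IsNilpotent.commute_of_isPGroup_of_ne {G : Type*} [Group G] [Finite G]
    [Group.IsNilpotent G] {p q : ℕ} [Fact p.Prime] [Fact q.Prime] (hpq : p ≠ q)
    {A B : Subgroup G} (hA : IsPGroup p A) (hB : IsPGroup q B) {a b : G} (ha : a ∈ A)
    (hb : b ∈ B) : Commute a b := by
  obtain ⟨P, hP⟩ := hA.exists_le_sylow
  obtain ⟨Q, hQ⟩ := hB.exists_le_sylow
  exact Subgroup.commute_of_normal_of_disjoint P Q inferInstance inferInstance
    (IsPGroup.disjoint_of_ne p q hpq _ _ P.isPGroup' Q.isPGroup') a b (hP ha) (hQ hb)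

theorem mem_upperCentralSeries_succ_of_forall_exists_sylow {G : Type*} [Group G] [Finite G]
    {n : ℕ} {x : G} (h : ∀ p : ℕ, p.Prime → ∃ P : Sylow p G,
      ∀ g ∈ P, ⁅x, g⁆ ∈ Subgroup.upperCentralSeries G n) :
    x ∈ Subgroup.upperCentralSeries G (n + 1) := by
  set π := QuotientGroup.mk' (Subgroup.upperCentralSeries G n)
  have hmem : ∀ g, g ∈ (Subgroup.centralizer {π x}).comap π ↔
      ⁅x, g⁆ ∈ Subgroup.upperCentralSeries G n := fun g => by
    rw [← QuotientGroup.eq_one_iff (N := Subgroup.upperCentralSeries G n),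
      ← QuotientGroup.mk'_apply, map_commutatorElement, commutatorElement_eq_one_iff_mul_comm,
      Subgroup.mem_comap, Subgroup.mem_centralizer_singleton_iff, eq_comm]
  have htop := Subgroup.eq_top_of_forall_exists_sylow_le ((Subgroup.centralizer {π x}).comap π)
    fun p hp => (h p hp).imp fun P hP g hg => (hmem g).mpr (hP g hg)
  exact Subgroup.mem_upperCentralSeries_succ_iff.mpr fun g =>
    (hmem g).mp (htop ▸ Subgroup.mem_top g)

section

variable {G : Type*} [Group G]

theorem normal_iInf_isMaximalNilpotent :
    (⨅ U ∈ {U : Subgroup G | IsMaximalNilpotent U}, U).Normal := by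
  refine ⟨fun x hx g => ?_⟩
  simp only [Subgroup.mem_iInf, Set.mem_ofPred_eq] at hx ⊢
  intro U hU
  have := hx _ (hU.map_mulEquiv (MulAut.conj g⁻¹))
  obtain ⟨u, hu, rfl⟩ := this
  simpa [mul_assoc] using hu

variable [Finite G]

theorem commute_of_mem_iInf_isMaximalNilpotent {p q : ℕ} [Fact p.Prime] [Fact q.Prime]
    (hpq : p ≠ q) (P : Sylow p G) (Q : Sylow q G) {x g : G}
    (hx : x ∈ ⨅ U ∈ {U : Subgroup G | IsMaximalNilpotent U}, U) (hxP : x ∈ P) (hg : g ∈ Q) :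
    Commute x g := by
  obtain ⟨U, hQU, hU⟩ := exists_isMaximalNilpotent_ge (Q : Subgroup G) Q.isPGroup'.isNilpotent
  simp only [Subgroup.mem_iInf, Set.mem_ofPred_eq] at hx
  have := hU.1
  have h : Commute (⟨x, hx U hU⟩ : U) ⟨g, hQU hg⟩ :=
    Group.IsNilpotent.commute_of_isPGroup_of_ne hpq
      (A := (P : Subgroup G).subgroupOf U) (B := (Q : Subgroup G).subgroupOf U)
      (P.isPGroup'.comap_of_injective _ U.subtype_injective)
      (Q.isPGroup'.comap_of_injective _ U.subtype_injective) hxP hg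
  exact h.map U.subtype

theorem mem_upperCentralSeries_of_mem_sylow {p : ℕ} [Fact p.Prime] (P : Sylow p G) (n : ℕ)
    (x : P) (hx : (x : G) ∈ ⨅ U ∈ {U : Subgroup G | IsMaximalNilpotent U}, U)
    (hxn : x ∈ Subgroup.upperCentralSeries P n) :
    (x : G) ∈ Subgroup.upperCentralSeries G n := by
  induction n generalizing x with
  | zero => simpa using hxn
  | succ n ih =>
    refine mem_upperCentralSeries_succ_of_forall_exists_sylow fun q hq => ?_
    have : Fact q.Prime := ⟨hq⟩
    by_cases hpq : p = q
    · subst hpq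
      refine ⟨P, fun g hg => ?_⟩
      refine ih ⁅x, ⟨g, hg⟩⁆ ?_ (Subgroup.mem_upperCentralSeries_succ_iff.mp hxn _)
      have hconj := normal_iInf_isMaximalNilpotent.conj_mem _ (inv_mem hx) g
      simpa [commutatorElement_def, mul_assoc] using mul_mem hx hconj
    · refine ⟨default, fun g hg => ?_⟩
      rw [commutatorElement_eq_one_iff_commute.mpr
        (commute_of_mem_iInf_isMaximalNilpotent hpq P _ hx x.2 hg)]
      exact one_mem _

theorem iInf_isMaximalNilpotent_le_hypercenter :
    (⨅ U ∈ {U : Subgroup G | IsMaximalNilpotent U}, U) ≤ hypercenter G := by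
  set D := ⨅ U ∈ {U : Subgroup G | IsMaximalNilpotent U}, U
  rw [← Subgroup.subgroupOf_eq_top]
  refine Subgroup.eq_top_of_forall_exists_sylow_le _ fun p hp => ⟨default, fun x hx => ?_⟩
  have : Fact p.Prime := ⟨hp⟩
  obtain ⟨P, hP⟩ := ((default : Sylow p D).isPGroup'.map D.subtype).exists_le_sylow
  have hxP : (x : G) ∈ P := hP (Subgroup.mem_map_of_mem _ hx)
  obtain ⟨n, hn⟩ := P.isPGroup'.isNilpotent.nilpotent
  exact upperCentralSeries_le_hypercenter G n
    (mem_upperCentralSeries_of_mem_sylow P n ⟨x, hxP⟩ x.2 (hn ▸ Subgroup.mem_top _))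

end

/-- For every finite group `G`, the intersection of all maximal nilpotent subgroups of `G`
equals the hypercenter of `G`. -/
theorem intersection_maximal_nilpotent_eq_hypercenter
    (G : Type*) [Group G] [Finite G] :
    (⨅ U ∈ {U : Subgroup G | IsMaximalNilpotent U}, U) = hypercenter G := by
  exact le_antisymm iInf_isMaximalNilpotent_le_hypercenter
    (le_iInf₂ fun _ hU => hypercenter_le_of_isMaximalNilpotent hU)
end

section
/- Let G be a finite group, p a prime, and let D be the intersection of all maximal p-decomposable subgroups of G. Then D is a normal subgroup of G, D = O_p(D) × O_{p'}(D) (i.e., D is p-decomposable), every chief factor H/K of G below O_p(D) satisfies C_G(H/K) = G (G induces the trivial group of automorphisms on it), every chief factor H/K of G below O_{p'}(D) satisfies that the order of G/C_G(H/K) is coprime to p, and D contains every normal subgroup N of G enjoying these same three properties (N is p-decomposable, chief factors of G below O_p(N) are centralized by G, and chief factors of G below O_{p'}(N) have G/C_G(H/K) of order coprime to p). Thus D is the largest such normal subgroup of G. -/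
/-- `H/K` is a chief factor of `G`: `H` and `K` are normal subgroups of `G` with `K < H`
and there is no normal subgroup of `G` strictly between `K` and `H`. -/
structure IsChiefFactor (G : Type*) [Group G] (H K : Subgroup G) : Prop where
  normalH : H.Normal
  normalK : K.Normal
  lt : K < H
  step : ∀ L : Subgroup G, L.Normal → K ≤ L → L ≤ H → L = K ∨ L = H

/-- The centralizer `C_G(H/K) = {g ∈ G | g h g⁻¹ h⁻¹ ∈ K for all h ∈ H}` of a factor
`H/K` of `G`, where `H` and `K` are normal subgroups of `G`. -/
def chiefCentralizer (G : Type*) [Group G] (H K : Subgroup G)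
    (hH : H.Normal) (hK : K.Normal) : Subgroup G where
  carrier := {g : G | ∀ h ∈ H, g * h * g⁻¹ * h⁻¹ ∈ K}
  one_mem' := by
    intro h hh
    have e : (1 : G) * h * 1⁻¹ * h⁻¹ = 1 := by group
    rw [e]
    exact K.one_mem
  mul_mem' := by
    intro a b ha hb h hh
    have hh' : b * h * b⁻¹ ∈ H := hH.conj_mem h hh b
    have key := mul_mem (ha _ hh') (hb h hh)
    have e : a * (b * h * b⁻¹) * a⁻¹ * (b * h * b⁻¹)⁻¹ * (b * h * b⁻¹ * h⁻¹) =
        a * b * h * (a * b)⁻¹ * h⁻¹ := by group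
    rw [e] at key
    exact key
  inv_mem' := by
    intro a ha h hh
    have hh' : a⁻¹ * h * a ∈ H := by simpa using hH.conj_mem h hh a⁻¹
    have key := inv_mem (ha _ hh')
    have e : (a * (a⁻¹ * h * a) * a⁻¹ * (a⁻¹ * h * a)⁻¹)⁻¹ = a⁻¹ * h * a⁻¹⁻¹ * h⁻¹ := by
      group
    rw [e] at key
    exact key

theorem mem_chiefCentralizer {G : Type*} [Group G] {H K : Subgroup G}
    {hH : H.Normal} {hK : K.Normal} {g : G} :
    g ∈ chiefCentralizer G H K hH hK ↔ ∀ h ∈ H, g * h * g⁻¹ * h⁻¹ ∈ K :=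
  Iff.rfl

/-- The centralizer of a chief factor is a normal subgroup of `G`. -/
theorem chiefCentralizer_normal (G : Type*) [Group G] (H K : Subgroup G)
    (hH : H.Normal) (hK : K.Normal) : (chiefCentralizer G H K hH hK).Normal := by
  constructor
  intro n hn g h hh
  have hh' : g⁻¹ * h * g ∈ H := by simpa using hH.conj_mem h hh g⁻¹
  have key := hK.conj_mem _ (hn _ hh') g
  have e : g * (n * (g⁻¹ * h * g) * n⁻¹ * (g⁻¹ * h * g)⁻¹) * g⁻¹ =
      g * n * g⁻¹ * h * (g * n * g⁻¹)⁻¹ * h⁻¹ := by group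
  rw [e] at key
  exact key

/-- A finite group is `p`-decomposable if it is the direct product of a (normal) Sylow
`p`-subgroup and a (normal) subgroup of order coprime to `p`. -/
def IsPDecomposable (p : ℕ) (X : Type*) [Group X] : Prop :=
  ∃ P N : Subgroup X, P.Normal ∧ N.Normal ∧ IsPGroup p P ∧ (Nat.card N).Coprime p ∧
    P ⊔ N = ⊤ ∧ P ⊓ N = ⊥

/-- `U` is a maximal `p`-decomposable subgroup of `G`. -/
def IsMaximalPDecomposable (p : ℕ) {G : Type*} [Group G] (U : Subgroup G) : Prop :=
  IsPDecomposable p U ∧ ∀ V : Subgroup G, U ≤ V → IsPDecomposable p V → U = V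

/-- `P = O_p(X)`: `P` is the largest normal `p`-subgroup of `X`. -/
def IsPCore (p : ℕ) (X : Type*) [Group X] (P : Subgroup X) : Prop :=
  P.Normal ∧ IsPGroup p P ∧ ∀ M : Subgroup X, M.Normal → IsPGroup p M → M ≤ P

/-- `N = O_{p'}(X)`: `N` is the largest normal subgroup of `X` of order coprime to `p`. -/
def IsPPrimeCore (p : ℕ) (X : Type*) [Group X] (N : Subgroup X) : Prop :=
  N.Normal ∧ (Nat.card N).Coprime p ∧
    ∀ M : Subgroup X, M.Normal → (Nat.card M).Coprime p → M ≤ N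

/-- The three properties of a subgroup `S` of `G` in the statement:
`S = O_p(S) × O_{p'}(S)` (i.e. `S` is `p`-decomposable); every chief factor `H/K` of `G`
below `O_p(S)` is centralized by `G` (i.e. `C_G(H/K) = G`); and every chief factor `H/K`
of `G` below `O_{p'}(S)` satisfies that the order of `G/C_G(H/K)`, i.e. the index of
`C_G(H/K)`, is coprime to `p`. -/
def PDecompHypercentralBelow (p : ℕ) {G : Type*} [Group G] (S : Subgroup G) : Prop :=
  ∃ P Q : Subgroup S, IsPCore p S P ∧ IsPPrimeCore p S Q ∧ P ⊔ Q = ⊤ ∧ P ⊓ Q = ⊥ ∧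
    (∀ H K : Subgroup G, IsChiefFactor G H K → H ≤ P.map S.subtype →
      ∀ g : G, ∀ h ∈ H, g * h * g⁻¹ * h⁻¹ ∈ K) ∧
    (∀ H K : Subgroup G, ∀ hcf : IsChiefFactor G H K, H ≤ Q.map S.subtype →
      ((chiefCentralizer G H K hcf.normalH hcf.normalK).index).Coprime p)

/-- `U` is generated by a `p`-subgroup `A` and a subgroup `B` of order coprime to `p`
which commute elementwise. -/
structure IsPSplitting (p : ℕ) {G : Type*} [Group G] (U A B : Subgroup G) : Prop where
  sup_eq : A ⊔ B = U
  isPGroup : IsPGroup p A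
  coprime : (Nat.card B).Coprime p
  commute : ∀ a ∈ A, ∀ b ∈ B, Commute a b

section Elements

variable {p : ℕ} {G : Type*} [Group G]

theorem eq_one_of_pow_prime_pow_eq_one {x : G} {k m : ℕ} (hx : x ^ p ^ k = 1)
    (hm : x ^ m = 1) (h : m.Coprime p) : x = 1 := by
  rw [← orderOf_eq_one_iff]
  exact Nat.eq_one_of_dvd_coprimes (h.pow_right k) (orderOf_dvd_of_pow_eq_one hm)
    (orderOf_dvd_of_pow_eq_one hx)

theorem IsPGroup.exists_pow_eq_one_of_mem {A : Subgroup G} (hA : IsPGroup p A) {a : G}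
    (ha : a ∈ A) : ∃ k : ℕ, a ^ p ^ k = 1 := by
  obtain ⟨k, hk⟩ := hA ⟨a, ha⟩
  exact ⟨k, by simpa [Subtype.ext_iff] using hk⟩

theorem Subgroup.orderOf_coprime_of_mem {B : Subgroup G} (hB : (Nat.card B).Coprime p) {b : G}
    (hb : b ∈ B) : (orderOf b).Coprime p :=
  hB.coprime_dvd_left (B.orderOf_dvd_natCard hb)

theorem Subgroup.card_coprime_of_orderOf_coprime [Finite G] (hp : p.Prime) {B : Subgroup G}
    (h : ∀ b ∈ B, (orderOf b).Coprime p) : (Nat.card B).Coprime p := by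
  rw [Nat.coprime_comm, hp.coprime_iff_not_dvd]
  intro hdvd
  have : Fact p.Prime := ⟨hp⟩
  obtain ⟨b, hb⟩ := exists_prime_orderOf_dvd_card' p hdvd
  have := h b b.2
  rw [Subgroup.orderOf_coe, hb, Nat.coprime_self] at this
  exact hp.ne_one this

/-- Every element of a finite group is the product of its `p`-part and its `p'`-part. -/
theorem exists_zpowers_mul_eq [Finite G] (hp : p.Prime) (x : G) :
    ∃ y ∈ Subgroup.zpowers x, ∃ z ∈ Subgroup.zpowers x,
      (∃ k : ℕ, y ^ p ^ k = 1) ∧ (orderOf z).Coprime p ∧ y * z = x := by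
  obtain ⟨e, m, hm, hn⟩ := Nat.exists_eq_pow_mul_and_not_dvd (orderOf_pos x).ne' p hp.ne_one
  have hmp : m.Coprime p := ((hp.coprime_iff_not_dvd).2 hm).symm
  obtain ⟨u, v, huv⟩ := Nat.isCoprime_iff_coprime.2 (hmp.pow_right e)
  have hx : x ^ ((p : ℤ) ^ e * m) = 1 := by
    have := pow_orderOf_eq_one x
    rw [hn] at this
    exact_mod_cast this
  refine ⟨x ^ (u * m), ⟨_, rfl⟩, x ^ (v * (p : ℤ) ^ e), ⟨_, rfl⟩, ⟨e, ?_⟩, ?_, ?_⟩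
  · rw [← zpow_natCast, ← zpow_mul, Nat.cast_pow,
      show u * m * (p : ℤ) ^ e = (p : ℤ) ^ e * m * u by ring, zpow_mul, hx, one_zpow]
  · refine hmp.coprime_dvd_left (orderOf_dvd_of_pow_eq_one ?_)
    rw [← zpow_natCast, ← zpow_mul,
      show v * (p : ℤ) ^ e * m = (p : ℤ) ^ e * m * v by ring, zpow_mul, hx, one_zpow]
  · rw [← zpow_add]
    simpa using congrArg (x ^ ·) huv

/-- If `g` centralizes `K` and the commutator of `g` and `h` lies in `K`, whose order is coprime
to the order of `g`, then `g` and `h` commute. -/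
theorem Commute.of_commutator_mem {K : Subgroup G} {g h : G}
    (hK : ∀ k ∈ K, Commute g k) (hgh : g * h * g⁻¹ * h⁻¹ ∈ K)
    (hco : (orderOf g).Coprime (Nat.card K)) : Commute g h := by
  obtain ⟨k, hk⟩ : ∃ k, k = g * h * g⁻¹ * h⁻¹ := ⟨_, rfl⟩
  rw [← hk] at hgh
  have hgk := hK k hgh
  have hpow : ∀ n : ℕ, g ^ n * h = k ^ n * h * g ^ n := by
    intro n
    induction n with
    | zero => simp
    | succ n ih =>
      have e : g * h = k * h * g := by rw [hk]; group
      calc g ^ (n + 1) * h = g * (g ^ n * h) := by rw [pow_succ']; group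
        _ = (g * k ^ n) * h * g ^ n := by rw [ih]; group
        _ = k ^ n * (g * h) * g ^ n := by rw [(hgk.pow_right n).eq]; group
        _ = k ^ (n + 1) * h * g ^ (n + 1) := by rw [e, pow_succ, pow_succ']; group
  have h1 : k ^ orderOf g = 1 := by
    have := hpow (orderOf g)
    rw [pow_orderOf_eq_one] at this
    simpa using this
  have h2 : k = 1 := by
    rw [← orderOf_eq_one_iff]
    exact Nat.eq_one_of_dvd_coprimes hco (orderOf_dvd_of_pow_eq_one h1)
      (K.orderOf_dvd_natCard hgh)
  have := hpow 1
  rw [h2] at this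
  simpa [Commute, SemiconjBy] using this

end Elements

namespace IsPSplitting

variable {p : ℕ} {G : Type*} [Group G] {U A B : Subgroup G}

theorem exists_mul_eq (h : IsPSplitting p U A B) {x : G} (hx : x ∈ U) :
    ∃ a ∈ A, ∃ b ∈ B, a * b = x := by
  rw [← h.sup_eq, ← SetLike.mem_coe, Subgroup.coe_mul_of_left_le_normalizer_right] at hx
  · exact hx
  · intro a ha
    rw [Subgroup.mem_normalizer_iff]
    have key : ∀ c ∈ A, ∀ b ∈ B, c * b * c⁻¹ ∈ B := fun c hc b hb => by
      rwa [(h.commute c hc b hb).eq, mul_inv_cancel_right]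
    intro b
    refine ⟨key a ha b, fun hb => ?_⟩
    have := key a⁻¹ (inv_mem ha) _ hb
    simpa [mul_assoc] using this

theorem left_le (h : IsPSplitting p U A B) : A ≤ U := h.sup_eq ▸ le_sup_left

theorem right_le (h : IsPSplitting p U A B) : B ≤ U := h.sup_eq ▸ le_sup_right

theorem mem_left (h : IsPSplitting p U A B) {x : G} (hx : x ∈ U)
    (hxp : ∃ k : ℕ, x ^ p ^ k = 1) : x ∈ A := by
  obtain ⟨a, ha, b, hb, rfl⟩ := h.exists_mul_eq hx
  obtain ⟨k, hk⟩ := hxp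
  obtain ⟨l, hl⟩ := h.isPGroup.exists_pow_eq_one_of_mem ha
  have hab := h.commute a ha b hb
  have hb1 : b ^ p ^ (k + l) = 1 := by
    have h1 : (a * b) ^ p ^ (k + l) = 1 := by rw [pow_add, pow_mul, hk, one_pow]
    have h2 : a ^ p ^ (k + l) = 1 := by rw [add_comm, pow_add, pow_mul, hl, one_pow]
    rwa [hab.mul_pow, h2, one_mul] at h1
  rw [eq_one_of_pow_prime_pow_eq_one hb1 (pow_orderOf_eq_one b)
    (Subgroup.orderOf_coprime_of_mem h.coprime hb), mul_one]
  exact ha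

theorem mem_right (h : IsPSplitting p U A B) {x : G} (hx : x ∈ U)
    (hxp : (orderOf x).Coprime p) : x ∈ B := by
  obtain ⟨a, ha, b, hb, rfl⟩ := h.exists_mul_eq hx
  obtain ⟨l, hl⟩ := h.isPGroup.exists_pow_eq_one_of_mem ha
  have hab := h.commute a ha b hb
  have ha1 : a ^ (orderOf (a * b) * orderOf b) = 1 := by
    have h1 : (a * b) ^ (orderOf (a * b) * orderOf b) = 1 := by
      rw [pow_mul, pow_orderOf_eq_one, one_pow]
    rwa [hab.mul_pow, mul_comm, pow_mul b, pow_orderOf_eq_one, one_pow, mul_one,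
      mul_comm] at h1
  rw [eq_one_of_pow_prime_pow_eq_one hl ha1
    (hxp.mul_left (Subgroup.orderOf_coprime_of_mem h.coprime hb)), one_mul]
  exact hb

theorem inf_eq_bot (h : IsPSplitting p U A B) : A ⊓ B = ⊥ := by
  rw [Subgroup.eq_bot_iff_forall]
  rintro x ⟨hA, hB⟩
  obtain ⟨l, hl⟩ := h.isPGroup.exists_pow_eq_one_of_mem hA
  exact eq_one_of_pow_prime_pow_eq_one hl (pow_orderOf_eq_one x)
    (Subgroup.orderOf_coprime_of_mem h.coprime hB)

theorem normal_left (h : IsPSplitting p U A B) (hU : U.Normal) : A.Normal := by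
  refine ⟨fun a ha g => h.mem_left (hU.conj_mem a (h.left_le ha) g) ?_⟩
  obtain ⟨k, hk⟩ := h.isPGroup.exists_pow_eq_one_of_mem ha
  exact ⟨k, by rw [conj_pow, hk]; group⟩

theorem normal_right (h : IsPSplitting p U A B) (hU : U.Normal) : B.Normal := by
  refine ⟨fun b hb g => h.mem_right (hU.conj_mem b (h.right_le hb) g) ?_⟩
  have : orderOf (g * b * g⁻¹) = orderOf b := (MulAut.conj g).orderOf_eq b
  rw [this]
  exact Subgroup.orderOf_coprime_of_mem h.coprime hb

theorem isPCore (h : IsPSplitting p ⊤ A B) : IsPCore p G A :=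
  ⟨h.normal_left inferInstance, h.isPGroup, fun _ _ hM _ hx =>
    h.mem_left trivial (hM.exists_pow_eq_one_of_mem hx)⟩

theorem isPPrimeCore (h : IsPSplitting p ⊤ A B) : IsPPrimeCore p G B :=
  ⟨h.normal_right inferInstance, h.coprime, fun _ _ hM _ hx =>
    h.mem_right trivial (Subgroup.orderOf_coprime_of_mem hM hx)⟩

theorem of_normal {A B : Subgroup G} (hA : A.Normal) (hB : B.Normal) (hpA : IsPGroup p A)
    (hpB : (Nat.card B).Coprime p) (hsup : A ⊔ B = ⊤) (hinf : A ⊓ B = ⊥) :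
    IsPSplitting p ⊤ A B :=
  ⟨hsup, hpA, hpB, fun a ha b hb =>
    Subgroup.commute_of_normal_of_disjoint A B hA hB (disjoint_iff.2 hinf) a b ha hb⟩

theorem subgroupOf (h : IsPSplitting p U A B) :
    IsPSplitting p ⊤ (A.subgroupOf U) (B.subgroupOf U) where
  sup_eq := by
    rw [← Subgroup.subgroupOf_sup h.left_le h.right_le, h.sup_eq, Subgroup.subgroupOf_self]
  isPGroup := h.isPGroup.of_equiv (Subgroup.subgroupOfEquivOfLe h.left_le).symm
  coprime := by
    rw [Nat.card_congr (Subgroup.subgroupOfEquivOfLe h.right_le).toEquiv]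
    exact h.coprime
  commute a ha b hb := Subtype.ext (h.commute a ha b hb).eq

theorem map_subtype {A B : Subgroup U} (h : IsPSplitting p ⊤ A B) :
    IsPSplitting p U (A.map U.subtype) (B.map U.subtype) where
  sup_eq := by
    rw [← Subgroup.map_sup, h.sup_eq, ← MonoidHom.range_eq_map, Subgroup.range_subtype]
  isPGroup := h.isPGroup.map _
  coprime := by
    rw [Subgroup.card_map_of_injective U.subtype_injective]
    exact h.coprime
  commute := by
    rintro _ ⟨a, ha, rfl⟩ _ ⟨b, hb, rfl⟩
    exact (h.commute a ha b hb).map U.subtype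

theorem isPDecomposable (h : IsPSplitting p U A B) : IsPDecomposable p U :=
  ⟨A.subgroupOf U, B.subgroupOf U, h.subgroupOf.isPCore.1, h.subgroupOf.isPPrimeCore.1,
    h.subgroupOf.isPGroup, h.subgroupOf.coprime, h.subgroupOf.sup_eq, h.subgroupOf.inf_eq_bot⟩

theorem inf_of_le [Finite G] (hp : p.Prime) (h : IsPSplitting p U A B) {D : Subgroup G}
    (hD : D ≤ U) : IsPSplitting p D (A ⊓ D) (B ⊓ D) where
  sup_eq := by
    refine le_antisymm (sup_le inf_le_right inf_le_right) fun x hx => ?_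
    obtain ⟨y, hy, z, hz, hyp, hzp, rfl⟩ := exists_zpowers_mul_eq hp x
    have hy' : y ∈ D := (Subgroup.zpowers_le.2 hx) hy
    have hz' : z ∈ D := (Subgroup.zpowers_le.2 hx) hz
    exact Subgroup.mul_mem_sup ⟨h.mem_left (hD hy') hyp, hy'⟩ ⟨h.mem_right (hD hz') hzp, hz'⟩
  isPGroup := h.isPGroup.to_le inf_le_left
  coprime := h.coprime.coprime_dvd_left (Subgroup.card_dvd_of_le inf_le_left)
  commute a ha b hb := h.commute a ha.1 b hb.1

end IsPSplitting

theorem IsPDecomposable.exists_isPSplitting {p : ℕ} {G : Type*} [Group G] {U : Subgroup G}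
    (h : IsPDecomposable p U) : ∃ A B : Subgroup G, IsPSplitting p U A B := by
  obtain ⟨P, N, hP, hN, hpP, hpN, hsup, hinf⟩ := h
  exact ⟨_, _, (IsPSplitting.of_normal hP hN hpP hpN hsup hinf).map_subtype⟩

section Maximal

variable {p : ℕ} {G : Type*} [Group G]

theorem IsPDecomposable.exists_le_maximal [Finite G] {V : Subgroup G}
    (h : IsPDecomposable p V) : ∃ U : Subgroup G, V ≤ U ∧ IsMaximalPDecomposable p U := by
  obtain ⟨U, hVU, hU⟩ := (Set.toFinite {U : Subgroup G | IsPDecomposable p U}).exists_le_maximal h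
  exact ⟨U, hVU, hU.prop, fun W hUW hW => hU.eq_of_le hW hUW⟩

theorem isPDecomposable_map_conj {U : Subgroup G} (g : G) (h : IsPDecomposable p U) :
    IsPDecomposable p (U.map (MulAut.conj g).toMonoidHom) := by
  obtain ⟨A, B, hAB⟩ := h.exists_isPSplitting
  refine IsPSplitting.isPDecomposable (A := A.map (MulAut.conj g).toMonoidHom)
    (B := B.map (MulAut.conj g).toMonoidHom) ⟨?_, hAB.isPGroup.map _, ?_, ?_⟩
  · rw [← Subgroup.map_sup, hAB.sup_eq]
  · rw [Subgroup.card_map_of_injective (MulAut.conj g).injective]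
    exact hAB.coprime
  · rintro _ ⟨a, ha, rfl⟩ _ ⟨b, hb, rfl⟩
    exact (hAB.commute a ha b hb).map _

theorem isMaximalPDecomposable_map_conj {U : Subgroup G} (g : G)
    (h : IsMaximalPDecomposable p U) :
    IsMaximalPDecomposable p (U.map (MulAut.conj g).toMonoidHom) := by
  have hinv : ∀ W : Subgroup G,
      (W.map (MulAut.conj g⁻¹).toMonoidHom).map (MulAut.conj g).toMonoidHom = W := by
    intro W
    ext x
    simp [Subgroup.mem_map, mul_assoc]
  have hinv' : ∀ W : Subgroup G,
      (W.map (MulAut.conj g).toMonoidHom).map (MulAut.conj g⁻¹).toMonoidHom = W := by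
    intro W
    ext x
    simp [Subgroup.mem_map, mul_assoc]
  refine ⟨isPDecomposable_map_conj g h.1, fun V hUV hV => ?_⟩
  have hle : U ≤ V.map (MulAut.conj g⁻¹).toMonoidHom := by
    rw [← hinv' U]
    exact Subgroup.map_mono hUV
  rw [h.2 _ hle (isPDecomposable_map_conj g⁻¹ hV), hinv]

theorem iInf_isMaximalPDecomposable_normal :
    (⨅ U ∈ {U : Subgroup G | IsMaximalPDecomposable p U}, U).Normal := by
  constructor
  intro x hx g
  simp only [Subgroup.mem_iInf, Set.mem_ofPred_eq] at hx ⊢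
  intro U hU
  obtain ⟨y, hy, hyx⟩ := hx _ (isMaximalPDecomposable_map_conj g⁻¹ hU)
  have : g * x * g⁻¹ = y := by
    rw [← hyx]
    simp [mul_assoc]
  rwa [this]

theorem isPDecomposable_zpowers_of_pow {x : G} (h : ∃ k : ℕ, x ^ p ^ k = 1) :
    IsPDecomposable p (Subgroup.zpowers x) := by
  refine IsPSplitting.isPDecomposable (A := Subgroup.zpowers x) (B := ⊥)
    ⟨sup_bot_eq _, ?_, by simp, ?_⟩
  · rintro ⟨_, n, rfl⟩
    obtain ⟨k, hk⟩ := h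
    refine ⟨k, Subtype.ext ?_⟩
    change (x ^ n) ^ p ^ k = 1
    rw [← zpow_natCast, zpow_comm, zpow_natCast, hk, one_zpow]
  · intro a _ b hb
    rw [Subgroup.mem_bot.1 hb]
    exact Commute.one_right a

theorem isPDecomposable_zpowers_of_coprime {x : G} (h : (orderOf x).Coprime p) :
    IsPDecomposable p (Subgroup.zpowers x) := by
  refine IsPSplitting.isPDecomposable (A := ⊥) (B := Subgroup.zpowers x)
    ⟨bot_sup_eq _, IsPGroup.of_bot, by rwa [Nat.card_zpowers], ?_⟩
  intro a ha b _
  rw [Subgroup.mem_bot.1 ha]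
  exact Commute.one_left b

theorem commute_of_le_maximal_of_pow [Finite G] {B : Subgroup G}
    (hB : (Nat.card B).Coprime p) (hle : ∀ U, IsMaximalPDecomposable p U → B ≤ U)
    {g : G} (hg : ∃ k : ℕ, g ^ p ^ k = 1) : ∀ b ∈ B, Commute g b := by
  intro b hb
  obtain ⟨U, hgU, hU⟩ := (isPDecomposable_zpowers_of_pow hg).exists_le_maximal
  obtain ⟨P, Q, hPQ⟩ := hU.1.exists_isPSplitting
  exact hPQ.commute g (hPQ.mem_left (hgU (Subgroup.mem_zpowers g)) hg) b
    (hPQ.mem_right (hle U hU hb) (Subgroup.orderOf_coprime_of_mem hB hb))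

theorem commute_of_le_maximal_of_coprime [Finite G] {A : Subgroup G}
    (hA : IsPGroup p A) (hle : ∀ U, IsMaximalPDecomposable p U → A ≤ U)
    {g : G} (hg : (orderOf g).Coprime p) : ∀ a ∈ A, Commute g a := by
  intro a ha
  obtain ⟨U, hgU, hU⟩ := (isPDecomposable_zpowers_of_coprime hg).exists_le_maximal
  obtain ⟨P, Q, hPQ⟩ := hU.1.exists_isPSplitting
  exact (hPQ.commute a (hPQ.mem_left (hle U hU ha) (hA.exists_pow_eq_one_of_mem ha)) g
    (hPQ.mem_right (hgU (Subgroup.mem_zpowers g)) hg)).symm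

end Maximal

section ChiefFactor

variable {p : ℕ} {G : Type*} [Group G] [Finite G]

theorem Subgroup.index_coprime_iff_forall_mem (hp : p.Prime) (C : Subgroup G) [C.Normal] :
    C.index.Coprime p ↔ ∀ g : G, (∃ k : ℕ, g ^ p ^ k = 1) → g ∈ C := by
  constructor
  · rintro h g ⟨k, hk⟩
    rw [← QuotientGroup.eq_one_iff]
    refine eq_one_of_pow_prime_pow_eq_one (k := k) (m := C.index) ?_ ?_ h
    · rw [← QuotientGroup.mk_pow, hk, QuotientGroup.mk_one]
    · exact pow_card_eq_one'
  · intro h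
    rw [Nat.coprime_comm, hp.coprime_iff_not_dvd]
    intro hdvd
    have : Fact p.Prime := ⟨hp⟩
    obtain ⟨x, hx⟩ := exists_prime_orderOf_dvd_card' (G := G ⧸ C) p hdvd
    obtain ⟨g, rfl⟩ := QuotientGroup.mk_surjective x
    obtain ⟨y, -, z, -, hy, hz, rfl⟩ := exists_zpowers_mul_eq hp g
    rw [QuotientGroup.mk_mul, (QuotientGroup.eq_one_iff y).2 (h y hy), one_mul] at hx
    have hdvd' : p ∣ orderOf z := hx ▸ orderOf_map_dvd (QuotientGroup.mk' C) z
    exact hp.ne_one (Nat.eq_one_of_dvd_coprimes hz hdvd' dvd_rfl)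

/-- A `p`-chief factor on which all `p'`-elements act trivially is central. -/
theorem IsChiefFactor.commutator_mem (hp : p.Prime) {H K : Subgroup G}
    (hHK : IsChiefFactor G H K) (hH : IsPGroup p H)
    (hco : ∀ g : G, (orderOf g).Coprime p → ∀ h ∈ H, Commute g h) :
    ∀ g : G, ∀ h ∈ H, g * h * g⁻¹ * h⁻¹ ∈ K := by
  have : Fact p.Prime := ⟨hp⟩
  have hHn := hHK.normalH
  have hKn := hHK.normalK
  have key : ∀ g h : G, g * h * g⁻¹ * h⁻¹ ∈ K ↔ Commute (g : G ⧸ K) (h : G ⧸ K) := by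
    intro g h
    rw [← QuotientGroup.eq_one_iff, QuotientGroup.mk_mul, QuotientGroup.mk_mul,
      QuotientGroup.mk_mul, QuotientGroup.mk_inv, QuotientGroup.mk_inv, mul_inv_eq_one,
      mul_inv_eq_iff_eq_mul]
    rfl
  let M : Subgroup (G ⧸ K) := H.map (QuotientGroup.mk' K)
  have hMn : M.Normal := hHn.map _ (QuotientGroup.mk'_surjective K)
  let P : Sylow p G := default
  let φ : (P : Subgroup G) →* MulAut M :=
    MulAut.conjNormal.comp ((QuotientGroup.mk' K).comp (P : Subgroup G).subtype)
  let act : MulAction (P : Subgroup G) M := MulAction.compHom M φ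
  have hM : IsPGroup p M := hH.map _
  have hMnt : Nontrivial M := by
    rw [Subgroup.nontrivial_iff_ne_bot]
    intro hbot
    have : H ≤ K := by
      have := (Subgroup.map_eq_bot_iff H).1 hbot
      rwa [QuotientGroup.ker_mk'] at this
    exact hHK.lt.not_ge this
  have hdvd : p ∣ Nat.card M := by
    obtain ⟨n, hn, hcard⟩ := hM.nontrivial_iff_card.1 hMnt
    rw [hcard]
    exact dvd_pow_self p hn.ne'
  have hone : (1 : M) ∈ MulAction.fixedPoints (P : Subgroup G) M := fun x => map_one (φ x)
  obtain ⟨b, hb, hb1⟩ := P.isPGroup'.exists_fixed_point_of_prime_dvd_card_of_fixed_point M hdvd hone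
  obtain ⟨⟨_, h, hh, rfl⟩, hbdef⟩ : ∃ c, c = b := ⟨b, rfl⟩
  have hhK : h ∉ K := by
    intro hk
    refine hb1 ?_
    rw [← hbdef]
    exact Subtype.ext ((QuotientGroup.eq_one_iff h).2 hk).symm
  let S : Subgroup G := (Subgroup.centralizer {(h : G ⧸ K)}).comap (QuotientGroup.mk' K)
  have hSmem : ∀ g : G, g ∈ S ↔ Commute (g : G ⧸ K) (h : G ⧸ K) := by
    intro g
    rw [Subgroup.mem_comap, Subgroup.mem_centralizer_singleton_iff]
    rfl
  have hPS : (P : Subgroup G) ≤ S := by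
    intro x hx
    rw [hSmem]
    have h1 := congrArg Subtype.val (hb ⟨x, hx⟩)
    rw [← hbdef] at h1
    have h2 : (x : G ⧸ K) * h * (x : G ⧸ K)⁻¹ = h := h1
    exact mul_inv_eq_iff_eq_mul.1 h2
  have hS : S = ⊤ := by
    rw [← Subgroup.index_eq_one]
    by_contra hne
    obtain ⟨q, hq, hqd⟩ := Nat.exists_prime_and_dvd hne
    have : Fact q.Prime := ⟨hq⟩
    by_cases hqp : q = p
    · subst hqp
      exact P.not_dvd_index (hqd.trans (Subgroup.index_dvd_of_le hPS))
    · let Q : Sylow q G := default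
      refine Q.not_dvd_index (hqd.trans (Subgroup.index_dvd_of_le fun x hx => ?_))
      rw [hSmem]
      refine (hco x ?_ h hh).map (QuotientGroup.mk' K)
      obtain ⟨k, hk⟩ := Q.isPGroup'.exists_pow_eq_one_of_mem hx
      exact (((Nat.coprime_primes hq hp).2 hqp).pow_left k).coprime_dvd_left
        (orderOf_dvd_of_pow_eq_one hk)
  let L : Subgroup G := (Subgroup.center (G ⧸ K)).comap (QuotientGroup.mk' K) ⊓ H
  have hLn : L.Normal := inferInstance
  have hLmem : ∀ x ∈ L, ∀ g : G, g * x * g⁻¹ * x⁻¹ ∈ K := by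
    intro x hx g
    rw [key]
    exact Subgroup.mem_center_iff.1 hx.1 g
  have hKL : K ≤ L := by
    refine le_inf (fun x hx => ?_) hHK.lt.le
    rw [Subgroup.mem_comap, QuotientGroup.mk'_apply, (QuotientGroup.eq_one_iff x).2 hx]
    exact one_mem _
  have hhL : h ∈ L := by
    refine ⟨Subgroup.mem_center_iff.2 fun y => ?_, hh⟩
    obtain ⟨g, rfl⟩ := QuotientGroup.mk_surjective y
    exact (hSmem g).1 (hS ▸ Subgroup.mem_top g)
  rcases hHK.step L hLn hKL inf_le_right with h1 | h1
  · exact absurd (h1 ▸ hhL) hhK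
  · intro g x hx
    exact hLmem x (h1 ▸ hx) g

theorem exists_isChiefFactor {H : Subgroup G} (hH : H.Normal) (hne : H ≠ ⊥) :
    ∃ K, IsChiefFactor G H K := by
  obtain ⟨K, -, hK⟩ := (Set.toFinite {K : Subgroup G | K.Normal ∧ K < H}).exists_le_maximal
    (a := ⊥) ⟨inferInstance, bot_lt_iff_ne_bot.2 hne⟩
  refine ⟨K, hH, hK.prop.1, hK.prop.2, fun L hL hKL hLH => ?_⟩
  by_cases h : L = H
  · exact Or.inr h
  · exact Or.inl (hK.eq_of_le ⟨hL, lt_of_le_of_ne hLH h⟩ hKL).symm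

/-- An element acting trivially on every chief factor of `G` below the normal subgroup `A`
whose order is coprime to `|A|` centralizes `A`. -/
theorem commute_of_forall_isChiefFactor {A : Subgroup G} (hA : A.Normal) {g : G}
    (hco : (orderOf g).Coprime (Nat.card A))
    (hcf : ∀ H K : Subgroup G, IsChiefFactor G H K → H ≤ A → ∀ h ∈ H, g * h * g⁻¹ * h⁻¹ ∈ K) :
    ∀ a ∈ A, Commute g a := by
  suffices ∀ H : Subgroup G, H.Normal → H ≤ A → ∀ h ∈ H, Commute g h from this A hA le_rfl
  intro H
  induction H using WellFoundedLT.induction with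
  | ind H ih =>
    intro hH hHA h hh
    by_cases hbot : H = ⊥
    · rw [hbot, Subgroup.mem_bot] at hh
      rw [hh]
      exact Commute.one_right g
    · obtain ⟨K, hK⟩ := exists_isChiefFactor hH hbot
      have hKA := hK.lt.le.trans hHA
      exact Commute.of_commutator_mem (ih K hK.lt hK.normalK hKA) (hcf H K hK hHA h hh)
        (hco.coprime_dvd_right (Subgroup.card_dvd_of_le hKA))

end ChiefFactor

theorem PDecompHypercentralBelow.of_le_maximal {p : ℕ} (hp : p.Prime) {G : Type*} [Group G]
    [Finite G] {D : Subgroup G} (hD : ∀ U, IsMaximalPDecomposable p U → D ≤ U) :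
    PDecompHypercentralBelow p D := by
  have hbot : IsPDecomposable p (⊥ : Subgroup G) := by
    rw [← Subgroup.zpowers_one_eq_bot]
    exact isPDecomposable_zpowers_of_pow ⟨0, one_pow _⟩
  obtain ⟨U, -, hU⟩ := hbot.exists_le_maximal
  obtain ⟨P, Q, hPQ⟩ := hU.1.exists_isPSplitting
  have h := (hPQ.inf_of_le hp (hD U hU)).subgroupOf
  have h' := h.map_subtype
  refine ⟨_, _, h.isPCore, h.isPPrimeCore, h.sup_eq, h.inf_eq_bot, ?_, ?_⟩
  · intro H K hHK hH
    exact hHK.commutator_mem hp (h'.isPGroup.to_le hH) fun g hg x hx =>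
      commute_of_le_maximal_of_coprime h'.isPGroup
        (fun W hW => h'.left_le.trans (hD W hW)) hg x (hH hx)
  · intro H K hcf hH
    have := chiefCentralizer_normal G H K hcf.normalH hcf.normalK
    rw [Subgroup.index_coprime_iff_forall_mem hp]
    intro g hg x hx
    have hc := commute_of_le_maximal_of_pow h'.coprime
      (fun W hW => h'.right_le.trans (hD W hW)) hg x (hH hx)
    rw [hc.eq, mul_inv_cancel_right, mul_inv_cancel]
    exact one_mem K

theorem PDecompHypercentralBelow.le_of_isMaximalPDecomposable {p : ℕ} (hp : p.Prime)
    {G : Type*} [Group G] [Finite G] {N U : Subgroup G} (hN : N.Normal)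
    (h : PDecompHypercentralBelow p N) (hU : IsMaximalPDecomposable p U) : N ≤ U := by
  have : Fact p.Prime := ⟨hp⟩
  obtain ⟨A₀, B₀, hA₀, hB₀, hsup, hinf, hcA, hcB⟩ := h
  have hAB := (IsPSplitting.of_normal hA₀.1 hB₀.1 hA₀.2.1 hB₀.2.1 hsup hinf).map_subtype
  set A := A₀.map N.subtype
  set B := B₀.map N.subtype
  have hA := hAB.normal_left hN
  have hB := hAB.normal_right hN
  have hcomA : ∀ g : G, (orderOf g).Coprime p → ∀ a ∈ A, Commute g a := by
    intro g hg
    obtain ⟨n, hn⟩ := IsPGroup.iff_card.1 hAB.isPGroup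
    refine commute_of_forall_isChiefFactor hA ?_ fun H K hHK hH => hcA H K hHK hH g
    rw [hn]
    exact hg.pow_right n
  have hcomB : ∀ g : G, (∃ k : ℕ, g ^ p ^ k = 1) → ∀ b ∈ B, Commute g b := by
    intro g hg
    refine commute_of_forall_isChiefFactor hB ?_ fun H K hHK hH => ?_
    · obtain ⟨k, hk⟩ := hg
      exact (hAB.coprime.symm.pow_left k).coprime_dvd_left (orderOf_dvd_of_pow_eq_one hk)
    · have := chiefCentralizer_normal G H K hHK.normalH hHK.normalK
      exact (Subgroup.index_coprime_iff_forall_mem hp _).1 (hcB H K hHK hH) g hg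
  obtain ⟨P, Q, hPQ⟩ := hU.1.exists_isPSplitting
  have hV : IsPSplitting p ((P ⊔ A) ⊔ (Q ⊔ B)) (P ⊔ A) (Q ⊔ B) := by
    have hpA : IsPGroup p (P ⊔ A : Subgroup G) :=
      hPQ.isPGroup.to_sup_of_normal_right hAB.isPGroup
    have hpB : (Nat.card (Q ⊔ B : Subgroup G)).Coprime p := by
      refine Subgroup.card_coprime_of_orderOf_coprime hp fun b hb => ?_
      obtain ⟨z, hz, w, hw, rfl⟩ := Subgroup.mem_sup_of_normal_right.1 hb
      refine (hPQ.coprime.mul_left hAB.coprime).coprime_dvd_left (orderOf_dvd_of_pow_eq_one ?_)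
      have hmem : (z * w) ^ Nat.card Q ∈ B := by
        rw [← QuotientGroup.eq_one_iff, QuotientGroup.mk_pow, QuotientGroup.mk_mul,
          (QuotientGroup.eq_one_iff w).2 hw, mul_one, ← QuotientGroup.mk_pow,
          orderOf_dvd_iff_pow_eq_one.1 (Q.orderOf_dvd_natCard hz), QuotientGroup.mk_one]
      rw [pow_mul]
      exact orderOf_dvd_iff_pow_eq_one.1 (B.orderOf_dvd_natCard hmem)
    refine ⟨rfl, hpA, hpB, ?_⟩
    intro a ha b hb
    obtain ⟨x, hx, y, hy, rfl⟩ := Subgroup.mem_sup_of_normal_right.1 ha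
    have hyb := (hcomA b (Subgroup.orderOf_coprime_of_mem hpB hb) y hy).symm
    obtain ⟨z, hz, w, hw, rfl⟩ := Subgroup.mem_sup_of_normal_right.1 hb
    exact ((hPQ.commute x hx z hz).mul_right
      (hcomB x (hPQ.isPGroup.exists_pow_eq_one_of_mem hx) w hw)).mul_left hyb
  have hUV : U ≤ (P ⊔ A) ⊔ (Q ⊔ B) := by
    rw [← hPQ.sup_eq]
    exact sup_le_sup le_sup_left le_sup_left
  rw [hU.2 _ hUV hV.isPDecomposable, ← hAB.sup_eq]
  exact sup_le_sup le_sup_right le_sup_right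

/-- Let `D` be the intersection of all maximal `p`-decomposable subgroups of a finite
group `G`.  Then `D` is normal in `G`, `D = O_p(D) × O_{p'}(D)`, every chief factor of
`G` below `O_p(D)` is centralized by `G`, every chief factor `H/K` of `G` below
`O_{p'}(D)` has `|G/C_G(H/K)|` coprime to `p`, and `D` contains every normal subgroup of
`G` enjoying these same three properties; thus `D` is the largest such normal subgroup. -/
theorem intersection_maximal_pDecomposable
    (p : ℕ) (hp : p.Prime) (G : Type*) [Group G] [Finite G] (D : Subgroup G)
    (hD : D = ⨅ U ∈ {U : Subgroup G | IsMaximalPDecomposable p U}, U) :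
    D.Normal ∧ PDecompHypercentralBelow p D ∧
      ∀ N : Subgroup G, N.Normal → PDecompHypercentralBelow p N → N ≤ D := by
  subst hD
  refine ⟨iInf_isMaximalPDecomposable_normal,
    PDecompHypercentralBelow.of_le_maximal hp fun U hU => iInf₂_le U hU, fun N hN h => ?_⟩
  exact le_iInf₂ fun U hU => h.le_of_isMaximalPDecomposable hp hN hU
end

section
/- Let G be a finite group and let D be the intersection of all maximal subgroups of G among the subgroups H whose derived (commutator) subgroup H' is nilpotent. Then D is a normal subgroup of G, the derived subgroup D' of D is nilpotent, every chief factor H/K of G below D satisfies that G/C_G(H/K) is abelian, and D contains every normal subgroup N of G such that N' is nilpotent and G/C_G(H/K) is abelian for every chief factor H/K of G below N. Thus D is the largest such normal subgroup of G. -/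
/-- A group `X` has nilpotent derived subgroup if its commutator subgroup is nilpotent. -/
def HasNilpotentDerivedSubgroup (X : Type*) [Group X] : Prop :=
  Group.IsNilpotent ↥(commutator X)

/-- `U` is maximal among subgroups of `G` with nilpotent derived subgroup. -/
def IsMaximalNilpotentDerived {G : Type*} [Group G] (U : Subgroup G) : Prop :=
  HasNilpotentDerivedSubgroup U ∧
    ∀ V : Subgroup G, U ≤ V → HasNilpotentDerivedSubgroup V → U = V

theorem isPGroup_of_forall_not_dvd_card {X : Type*} [Group X] [Finite X] {p : ℕ}
    (hp : p.Prime) (h : ∀ r : ℕ, r.Prime → r ≠ p → ¬ r ∣ Nat.card X) : IsPGroup p X := by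
  rw [isPGroup_iff_primeFactors_card_subset hp.ne_zero]
  intro r hr
  obtain ⟨hr1, hr2, -⟩ := Nat.mem_primeFactors.1 hr
  by_contra hne
  refine h r hr1 (fun e => hne ?_) hr2
  rw [e, hp.primeFactors]
  exact Finset.mem_singleton_self p

theorem isNilpotent_subgroup_of_le {X : Type*} [Group X] {A B : Subgroup X} (h : A ≤ B)
    (hB : Group.IsNilpotent B) : Group.IsNilpotent A := by
  rw [Subgroup.isNilpotent_iff_lowerCentralSeries] at hB ⊢
  obtain ⟨n, hn⟩ := hB
  exact ⟨n, le_bot_iff.1 (hn ▸ Subgroup.lowerCentralSeries_mono n h)⟩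

theorem isNilpotent_subgroup_map {X Y : Type*} [Group X] [Group Y] {A : Subgroup X}
    (hA : Group.IsNilpotent A) (f : X →* Y) : Group.IsNilpotent (A.map f) := by
  rw [Subgroup.isNilpotent_iff_lowerCentralSeries] at hA ⊢
  obtain ⟨n, hn⟩ := hA
  exact ⟨n, by rw [← Subgroup.map_lowerCentralSeries, hn, Subgroup.map_bot]⟩

theorem le_centralizer_of_disjoint_commutator {X : Type*} [Group X] {V R : Subgroup X}
    (hRV : R ≤ V) (hV : V ≤ Subgroup.normalizer (R : Set X)) (h : Disjoint ⁅V, V⁆ R) :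
    V ≤ Subgroup.centralizer (R : Set X) := by
  rw [← Subgroup.commutator_eq_bot_iff_le_centralizer, ← le_bot_iff]
  exact h (Subgroup.commutator_mono le_rfl hRV)
    (Subgroup.le_normalizer_iff_commutator_le_right.1 hV)

theorem isNilpotent_sup_of_le_centralizer {X : Type*} [Group X] {A B : Subgroup X}
    [Group.IsNilpotent A] [Group.IsNilpotent B]
    (h : A ≤ Subgroup.centralizer (B : Set X)) : Group.IsNilpotent (A ⊔ B : Subgroup X) := by
  have hc : ∀ (a : A) (b : B), Commute (A.subtype a) (B.subtype b) :=
    fun a b => (h a.2 b b.2).symm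
  have e : (MonoidHom.noncommCoprod A.subtype B.subtype hc).range = A ⊔ B := by
    rw [MonoidHom.noncommCoprod_range, Subgroup.range_subtype, Subgroup.range_subtype]
  rw [← e]
  exact Group.nilpotent_of_surjective _ (MonoidHom.rangeRestrict_surjective _)

/-- If the derived subgroups of all proper subgroups of a finite group are `p`-groups, then its
derived subgroup is a `p`-group or nilpotent. -/
theorem isNilpotent_commutator_of_proper_isPGroup {B : Type*} [Group B] [Finite B] {p : ℕ}
    (hp : p.Prime) (hB : ¬ IsPGroup p (commutator B))
    (hV : ∀ V : Subgroup B, V ≠ ⊤ → IsPGroup p (⁅V, V⁆ : Subgroup B)) :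
    Group.IsNilpotent (commutator B) := by
  have : Fact p.Prime := ⟨hp⟩
  have hcent : ∀ (r : ℕ) (_ : Fact r.Prime) (V R : Subgroup B), r ≠ p → V ≠ ⊤ → IsPGroup r R →
      R ≤ V → V ≤ Subgroup.normalizer (R : Set B) → V ≤ Subgroup.centralizer (R : Set B) :=
    fun r _ V R hr hVt hR hRV hn =>
      le_centralizer_of_disjoint_commutator hRV hn
        (IsPGroup.disjoint_of_ne p r hr.symm _ _ (hV V hVt) hR)
  by_cases h : ∃ (r : ℕ) (_ : Fact r.Prime) (R : Sylow r B), r ≠ p ∧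
      ¬ Subgroup.normalizer (R : Set B) ≤ Subgroup.centralizer (R : Set B)
  · obtain ⟨r, hrF, R, hrp, hR⟩ := h
    have hnorm : Subgroup.normalizer (R : Set B) = ⊤ := by
      by_contra hne
      exact hR (hcent r hrF _ R hrp hne R.2 Subgroup.le_normalizer le_rfl)
    have hRn : (R : Subgroup B).Normal := Subgroup.normalizer_eq_top_iff.1 hnorm
    have hRnil : Group.IsNilpotent (R : Subgroup B) := R.2.isNilpotent
    obtain ⟨K, hK⟩ := Subgroup.exists_left_complement'_of_coprime R.card_coprime_index
    have hKt : K ≠ ⊤ := by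
      rintro rfl
      have : (R : Subgroup B) = ⊥ := Subgroup.isComplement'_top_left.1 hK
      refine hR fun x _ y hy => ?_
      have : y ∈ (⊥ : Subgroup B) := this ▸ hy
      rw [Subgroup.mem_bot.1 this, one_mul, mul_one]
    have hP : IsPGroup p (⁅K, K⁆ : Subgroup B) := hV K hKt
    have hPnil : Group.IsNilpotent (⁅K, K⁆ : Subgroup B) := hP.isNilpotent
    let q := QuotientGroup.mk' (R : Subgroup B)
    have hq : Function.Surjective q := QuotientGroup.mk'_surjective _
    have hcomm : commutator (B ⧸ (R : Subgroup B)) = (⁅K, K⁆ : Subgroup B).map q := by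
      have hKq : K.map q = ⊤ := by
        rw [← (Subgroup.comap_injective hq).eq_iff, Subgroup.comap_map_eq, QuotientGroup.ker_mk',
          Subgroup.comap_top]
        exact hK.sup_eq_top
      rw [Subgroup.map_commutator, hKq, commutator_def]
    have hle : commutator B ≤ ⁅K, K⁆ ⊔ R := by
      have : (commutator B).map q ≤ (⁅K, K⁆ : Subgroup B).map q := by
        rw [← hcomm]
        rw [commutator_def, commutator_def, Subgroup.map_commutator]
        exact Subgroup.commutator_mono le_top le_top
      rw [Subgroup.map_le_iff_le_comap, Subgroup.comap_map_eq, QuotientGroup.ker_mk'] at this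
      exact this
    have hnil : Group.IsNilpotent (⁅K, K⁆ ⊔ R : Subgroup B) := by
      by_cases ht : ⁅K, K⁆ ⊔ (R : Subgroup B) = ⊤
      · have hPq : (⁅K, K⁆ : Subgroup B).map q = ⊤ := by
          rw [← (Subgroup.comap_injective hq).eq_iff, Subgroup.comap_map_eq,
            QuotientGroup.ker_mk', Subgroup.comap_top, ht]
        have hQ : Group.IsNilpotent (B ⧸ (R : Subgroup B)) := by
          rw [← Group.isNilpotent_top, ← hPq]
          exact (hP.map q).isNilpotent
        have hsub : Subsingleton (B ⧸ (R : Subgroup B)) := by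
          by_contra hns
          rw [not_subsingleton_iff_nontrivial] at hns
          exact (Group.IsSolvable.commutator_lt_top_of_nontrivial (B ⧸ (R : Subgroup B))).ne
            (hcomm.trans hPq)
        rw [QuotientGroup.subsingleton_iff] at hsub
        rw [hsub, sup_top_eq, ← hsub]
        exact hRnil
      · exact isNilpotent_sup_of_le_centralizer
          (le_sup_left.trans (hcent r hrF _ R hrp ht R.2 le_sup_right Subgroup.le_normalizer_of_normal))
    exact isNilpotent_subgroup_of_le hle hnil
  · push Not at h
    refine absurd (isPGroup_of_forall_not_dvd_card hp fun r hr hrp hdvd => ?_) hB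
    have : Fact r.Prime := ⟨hr⟩
    obtain ⟨R⟩ : Nonempty (Sylow r B) := inferInstance
    have hR := h r ⟨hr⟩ R hrp
    have hle : commutator B ≤ (MonoidHom.transferSylow R hR).ker := by
      rw [commutator_def, Subgroup.commutator_le]
      intro x _ y _
      rw [MonoidHom.mem_ker, map_commutatorElement, commutatorElement_eq_one_iff_mul_comm]
      exact Subtype.ext (hR (Subgroup.le_normalizer (MonoidHom.transferSylow R hR y).2) _
        (MonoidHom.transferSylow R hR x).2)
    exact MonoidHom.not_dvd_card_ker_transferSylow R hR
      (hdvd.trans (Subgroup.card_dvd_of_le hle))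

/-- Nilpotency of the derived subgroup lifts along a surjection whose kernel has no proper
supplement. -/
theorem isNilpotent_commutator_of_surjective {U B : Type*} [Group U] [Group B] [Finite U]
    (f : U →* B) (hf : Function.Surjective f)
    (hker : ∀ V : Subgroup U, V ⊔ f.ker = ⊤ → V = ⊤)
    (hB : Group.IsNilpotent (commutator B)) : Group.IsNilpotent (commutator U) := by
  have hfin : Finite B := Finite.of_surjective f hf
  set Y : Subgroup U := (commutator B).comap f with hY
  have hYn : Group.IsNilpotent Y := by
    refine (Group.isNilpotent_of_finite_tfae.out 0 3 rfl rfl).2 fun q hq P => ?_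
    let g : Y →* commutator B := f.subgroupComap (commutator B)
    have hg : Function.Surjective g := f.subgroupComap_surjective_of_surjective _ hf
    let Q : Sylow q (commutator B) := P.mapSurjective hg
    have hQc : (Q : Subgroup (commutator B)).Characteristic :=
      Q.characteristic_of_normal inferInstance
    set P' : Subgroup U := (P : Subgroup Y).map Y.subtype with hP'
    have hQP : (Q : Subgroup (commutator B)).map (commutator B).subtype = P'.map f := by
      rw [Sylow.coe_mapSurjective, hP', Subgroup.map_map, Subgroup.map_map]
      rfl
    have hfP : (P'.map f).Normal := by
      rw [← hQP]
      infer_instance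
    set L : Subgroup U := (P'.map f).comap f with hL
    have hLn : L.Normal := hfP.comap f
    have hLe : L = P' ⊔ f.ker := Subgroup.comap_map_eq f P'
    have hLY : L ≤ Y := by
      refine Subgroup.comap_mono ?_
      rw [← hQP]
      exact Subgroup.map_subtype_le _
    have hPL : P' ≤ L := hLe ▸ le_sup_left
    have hPY : P'.subgroupOf Y = P := Subgroup.comap_map_eq_self_of_injective Y.subtype_injective _
    have hidx : ¬ q ∣ (P'.subgroupOf L).index := by
      intro hdvd
      have h1 : (P'.subgroupOf L).index ∣ (P'.subgroupOf Y).index :=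
        Dvd.intro _ (Subgroup.relIndex_mul_relIndex P' L Y hPL hLY)
      rw [hPY] at h1
      exact P.not_dvd_index (hdvd.trans h1)
    have hPp : IsPGroup q (P'.subgroupOf L) :=
      (P.2.map Y.subtype).comap_of_injective L.subtype L.subtype_injective
    have hfr := (hPp.toSylow hidx).normalizer_sup_eq_top
    rw [IsPGroup.toSylow_coe, Subgroup.map_subgroupOf_eq_of_le hPL, hLe, ← sup_assoc,
      sup_eq_left.2 Subgroup.le_normalizer] at hfr
    have hPn : P'.Normal := Subgroup.normalizer_eq_top_iff.1 (hker _ hfr)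
    rw [← hPY]
    exact hPn.subgroupOf Y
  have hle : commutator U ≤ Y := by
    rw [hY, ← Subgroup.map_le_iff_le_comap, commutator_def, commutator_def,
      Subgroup.map_commutator]
    exact Subgroup.commutator_mono le_top le_top
  exact isNilpotent_subgroup_of_le hle hYn

theorem hasNilpotentDerivedSubgroup_iff {X : Type*} [Group X] {U : Subgroup X} :
    HasNilpotentDerivedSubgroup U ↔ Group.IsNilpotent (⁅U, U⁆ : Subgroup X) := by
  rw [HasNilpotentDerivedSubgroup, ← U.map_subtype_commutator]
  exact Group.isNilpotent_congr
    ((commutator U).equivMapOfInjective U.subtype U.subtype_injective)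

theorem hasNilpotentDerivedSubgroup_bot (G : Type*) [Group G] :
    HasNilpotentDerivedSubgroup (⊥ : Subgroup G) :=
  inferInstanceAs (Group.IsNilpotent (commutator (⊥ : Subgroup G)))

theorem exists_isMaximalNilpotentDerived_ge {G : Type*} [Group G] [Finite G] {U : Subgroup G}
    (hU : HasNilpotentDerivedSubgroup U) :
    ∃ W : Subgroup G, IsMaximalNilpotentDerived W ∧ U ≤ W := by
  obtain ⟨W, hUW, hW⟩ :=
    (Set.toFinite {U : Subgroup G | HasNilpotentDerivedSubgroup U}).exists_le_maximal hU
  exact ⟨W, ⟨hW.prop, fun V h hV => h.antisymm (hW.le_of_ge hV h)⟩, hUW⟩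

theorem isSolvable_of_isNilpotent_commutator {X : Type*} [Group X]
    (h : Group.IsNilpotent (commutator X)) : Group.IsSolvable X := by
  refine (Group.isSolvable_iff_subgroup_quotient (commutator X)).2 ⟨inferInstance, ?_⟩
  exact inferInstanceAs (Group.IsSolvable (Abelianization X))

/-- A group whose image under `φ` has a derived subgroup that is not a `p`-group contains a
subgroup with the same property whose derived subgroup is nilpotent. -/
theorem exists_isNilpotent_commutator_not_isPGroup {G A : Type*} [Group G] [Group A] [Finite G]
    {p : ℕ} (hp : p.Prime) (φ : G →* A)
    (h : ¬ IsPGroup p ((⁅(⊤ : Subgroup G), ⊤⁆ : Subgroup G).map φ)) :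
    ∃ U : Subgroup G, HasNilpotentDerivedSubgroup U ∧
      ¬ IsPGroup p ((⁅U, U⁆ : Subgroup G).map φ) := by
  obtain ⟨U, -, hU⟩ := (Set.toFinite
    {U : Subgroup G | ¬ IsPGroup p ((⁅U, U⁆ : Subgroup G).map φ)}).exists_le_minimal h
  refine ⟨U, ?_, hU.prop⟩
  have hmin : ∀ V : Subgroup U,
      ¬ IsPGroup p ((⁅V.map U.subtype, V.map U.subtype⁆ : Subgroup G).map φ) → V = ⊤ := by
    intro V hV
    have := hU.le_of_le hV (Subgroup.map_subtype_le V)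
    rw [eq_top_iff, ← Subgroup.map_subtype_le_map_subtype, ← MonoidHom.range_eq_map,
      Subgroup.range_subtype]
    exact this
  set f := (φ.comp U.subtype).rangeRestrict with hfdef
  have hf : Function.Surjective f := MonoidHom.rangeRestrict_surjective _
  have hfin : Finite (φ.comp U.subtype).range := Finite.of_surjective f hf
  have hmap : ∀ V : Subgroup U, (V.map U.subtype).map φ
      = (V.map f).map (φ.comp U.subtype).range.subtype := by
    intro V
    rw [Subgroup.map_map, Subgroup.map_map]
    rfl
  have hcomm : ∀ V : Subgroup U, (⁅V.map U.subtype, V.map U.subtype⁆ : Subgroup G).map φ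
      = (⁅V.map f, V.map f⁆ : Subgroup _).map (φ.comp U.subtype).range.subtype := by
    intro V
    rw [Subgroup.map_commutator, hmap, Subgroup.map_commutator]
  have hUtop : (⊤ : Subgroup U).map U.subtype = U := by
    rw [← MonoidHom.range_eq_map, Subgroup.range_subtype]
  have hftop : (⊤ : Subgroup U).map f = ⊤ := by
    rw [← MonoidHom.range_eq_map, MonoidHom.range_eq_top.2 hf]
  have hUnot := hU.prop
  refine isNilpotent_commutator_of_surjective f hf (fun V hV => hmin V fun hVp => hUnot ?_)
    (isNilpotent_commutator_of_proper_isPGroup hp (fun hc => hUnot ?_) fun V hV => ?_)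
  · have e : V.map f = (⊤ : Subgroup U).map f := by
      rw [← hV, Subgroup.map_sup, (Subgroup.map_eq_bot_iff f.ker).2 le_rfl, sup_bot_eq]
    rw [hcomm, e, ← hcomm, hUtop] at hVp
    exact hVp
  · have := hcomm ⊤
    rw [hUtop, hftop] at this
    rw [this]
    exact hc.map _
  · by_contra hVp
    refine hV ?_
    have e : (V.comap f).map f = V := Subgroup.map_comap_eq_self_of_surjective hf V
    have htop := hmin (V.comap f) fun hq => hVp ?_
    · rw [← e, htop, hftop]
    · rw [hcomm, e] at hq
      have := hq.comap_of_injective _ (Subgroup.subtype_injective (φ.comp U.subtype).range)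
      rwa [Subgroup.comap_map_eq_self_of_injective (Subgroup.subtype_injective _)] at this

/-- A solvable minimal normal subgroup of a finite group is a `p`-group. -/
theorem exists_isPGroup_of_minimal_normal {Q : Type*} [Group Q] [Finite Q] {N : Subgroup Q}
    [hN : N.Normal] (hbot : N ≠ ⊥) (hmin : ∀ L : Subgroup Q, L.Normal → L ≤ N → L = ⊥ ∨ L = N)
    (hsol : Group.IsSolvable N) : ∃ p : ℕ, p.Prime ∧ IsPGroup p N := by
  have hnt : Nontrivial N := (Subgroup.nontrivial_iff_ne_bot N).2 hbot
  have hcomm : ⁅N, N⁆ = ⊥ := by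
    refine (hmin ⁅N, N⁆ inferInstance N.commutator_le_self).resolve_right fun h => ?_
    refine (Group.IsSolvable.commutator_lt_top_of_nontrivial N).ne ?_
    rw [← Subgroup.map_subtype_inj, N.map_subtype_commutator, h, ← MonoidHom.range_eq_map,
      Subgroup.range_subtype]
  have hnil : Group.IsNilpotent N := (Subgroup.isNilpotent_iff_lowerCentralSeries N).2 ⟨1, hcomm⟩
  obtain ⟨p, hp, hdvd⟩ := Nat.exists_prime_and_dvd (Finite.one_lt_card (α := N)).ne'
  have : Fact p.Prime := ⟨hp⟩
  obtain ⟨P⟩ : Nonempty (Sylow p N) := inferInstance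
  have hPc : (P : Subgroup N).Characteristic := P.characteristic_of_normal inferInstance
  refine ⟨p, hp, ?_⟩
  rcases hmin ((P : Subgroup N).map N.subtype) inferInstance (Subgroup.map_subtype_le _) with h | h
  · rw [Subgroup.map_eq_bot_iff_of_injective _ N.subtype_injective] at h
    exact absurd h (P.ne_bot_of_dvd_card hdvd)
  · rw [← h]
    exact P.2.map _

/-- If `N ≤ W` is a normal `p`-subgroup and `W` has nilpotent derived subgroup, then that derived
subgroup acts on `N` as a `p`-group. -/
theorem isPGroup_map_conjNormal_of_isNilpotent {Q : Type*} [Group Q] [Finite Q] {p : ℕ}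
    (hp : p.Prime) {N W : Subgroup Q} [hN : N.Normal] (hNp : IsPGroup p N) (hNW : N ≤ W)
    (hW : Group.IsNilpotent (commutator W)) :
    IsPGroup p ((⁅W, W⁆ : Subgroup Q).map (MulAut.conjNormal (H := N))) := by
  have : Fact p.Prime := ⟨hp⟩
  have hNn : (N.subgroupOf W).Normal := hN.subgroupOf W
  have hNWp : IsPGroup p (N.subgroupOf W) := hNp.comap_of_injective _ W.subtype_injective
  set g : commutator W →* MulAut N :=
    (MulAut.conjNormal (H := N)).comp (W.subtype.comp (commutator W).subtype) with hg
  have hrange : g.range = (⁅W, W⁆ : Subgroup Q).map (MulAut.conjNormal (H := N)) := by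
    rw [hg, MonoidHom.range_comp, MonoidHom.range_comp, Subgroup.range_subtype,
      W.map_subtype_commutator]
  rw [← hrange]
  refine isPGroup_of_forall_not_dvd_card hp fun r hr hrp hdvd => ?_
  have : Fact r.Prime := ⟨hr⟩
  obtain ⟨R⟩ : Nonempty (Sylow r (commutator W)) := inferInstance
  have hRc : (R : Subgroup (commutator W)).Characteristic :=
    R.characteristic_of_normal inferInstance
  set R' : Subgroup W := (R : Subgroup (commutator W)).map (commutator W).subtype
  have hR'n : R'.Normal := inferInstance
  have hdisj : Disjoint R' (N.subgroupOf W) :=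
    IsPGroup.disjoint_of_ne r p hrp _ _ (R.2.map _) hNWp
  have hbot : (R.mapSurjective g.rangeRestrict_surjective : Subgroup g.range) = ⊥ := by
    rw [Sylow.coe_mapSurjective, Subgroup.map_eq_bot_iff]
    intro x hx
    rw [MonoidHom.mem_ker]
    refine Subtype.ext (MulEquiv.ext fun n => Subtype.ext ?_)
    have hc := Subgroup.commute_of_normal_of_disjoint R' (N.subgroupOf W) hR'n hNn hdisj x
      ⟨n, hNW n.2⟩ (Subgroup.mem_map_of_mem _ hx) n.2
    have hc' : ((x : W) : Q) * n = n * ((x : W) : Q) := congrArg Subtype.val hc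
    change ((MulAut.conjNormal ((x : W) : Q) n : N) : Q) = n
    rw [MulAut.conjNormal_apply, hc', mul_inv_cancel_right]
  exact (R.mapSurjective g.rangeRestrict_surjective).ne_bot_of_dvd_card hdvd hbot

/-- A normal subgroup acting as a `p`-group on a minimal normal `p`-subgroup centralizes it. -/
theorem le_centralizer_of_isPGroup_map_conjNormal {Q : Type*} [Group Q] [Finite Q] {p : ℕ}
    (hp : p.Prime) {N T : Subgroup Q} [hN : N.Normal] [hT : T.Normal] (hbot : N ≠ ⊥)
    (hmin : ∀ L : Subgroup Q, L.Normal → L ≤ N → L = ⊥ ∨ L = N) (hNp : IsPGroup p N)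
    (h : IsPGroup p (T.map (MulAut.conjNormal (H := N)))) :
    N ≤ Subgroup.centralizer (T : Set Q) := by
  have : Fact p.Prime := ⟨hp⟩
  have hnt : Nontrivial N := (Subgroup.nontrivial_iff_ne_bot N).2 hbot
  have hdvd : p ∣ Nat.card N := hNp.card_eq_or_dvd.resolve_left (Finite.one_lt_card (α := N)).ne'
  obtain ⟨b, hb, hb1⟩ := h.exists_fixed_point_of_prime_dvd_card_of_fixed_point N hdvd
    (a := 1) (fun t => map_one (t : MulAut N))
  have hmem : (b : Q) ∈ N ⊓ Subgroup.centralizer (T : Set Q) := by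
    refine ⟨b.2, fun t ht => ?_⟩
    have := congrArg Subtype.val (hb ⟨MulAut.conjNormal t, Subgroup.mem_map_of_mem _ ht⟩)
    change ((MulAut.conjNormal t b : N) : Q) = b at this
    rwa [MulAut.conjNormal_apply, mul_inv_eq_iff_eq_mul] at this
  rcases hmin (N ⊓ Subgroup.centralizer (T : Set Q)) inferInstance inf_le_left with h0 | h0
  · rw [h0, Subgroup.mem_bot] at hmem
    exact absurd (Subtype.ext hmem.symm) hb1
  · exact inf_eq_left.1 h0

theorem quotient_chiefCentralizer_comm_iff {G : Type*} [Group G] {H K : Subgroup G}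
    (hH : H.Normal) (hK : K.Normal) :
    (letI := chiefCentralizer_normal G H K hH hK
      ∀ x y : G ⧸ chiefCentralizer G H K hH hK, x * y = y * x) ↔ ⁅commutator G, H⁆ ≤ K := by
  have hC := chiefCentralizer_normal G H K hH hK
  have h1 : ⁅commutator G, H⁆ ≤ K ↔ commutator G ≤ chiefCentralizer G H K hH hK :=
    Subgroup.commutator_le
  rw [h1, ← Subgroup.Normal.quotient_commutative_iff_commutator_le]
  exact ⟨fun h => ⟨⟨h⟩⟩, fun h => h.is_comm.comm⟩

/-- The derived subgroup acts hypercentrally on a normal subgroup below which it centralizes all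
chief factors. -/
theorem exists_lowerCentralSeries_eq_bot {G : Type*} [Group G] [Finite G] {X : Subgroup G}
    (hX : X ≤ commutator G) (M : Subgroup G) (hM : M.Normal)
    (hcf : ∀ H K : Subgroup G, IsChiefFactor G H K → H ≤ M → ⁅commutator G, H⁆ ≤ K)
    {n : ℕ} (hn : X.lowerCentralSeries n ≤ M) : ∃ m, X.lowerCentralSeries m = ⊥ := by
  induction M using WellFoundedLT.induction generalizing n with
  | ind M ih =>
    by_cases hbot : M = ⊥
    · exact ⟨n, le_bot_iff.1 (hbot ▸ hn)⟩
    · obtain ⟨L, hL⟩ := (Set.toFinite {L : Subgroup G | L.Normal ∧ L < M}).exists_maximal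
        ⟨⊥, inferInstance, bot_lt_iff_ne_bot.2 hbot⟩
      have hML : IsChiefFactor G M L := by
        refine ⟨hM, hL.prop.1, hL.prop.2, fun L' hn' h1 h2 => ?_⟩
        by_contra! hne
        exact hne.1 ((hL.le_of_ge ⟨hn', lt_of_le_of_ne h2 hne.2⟩ h1).antisymm h1)
      refine ih L hL.prop.2 hL.prop.1 (fun H K h hle => hcf H K h (hle.trans hL.prop.2.le))
        (n := n + 1) ?_
      rw [Subgroup.lowerCentralSeries_succ, Subgroup.commutator_comm]
      exact (Subgroup.commutator_mono hX hn).trans (hcf M L hML le_rfl)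

theorem hasNilpotentDerivedSubgroup_sup {G : Type*} [Group G] [Finite G] {N U : Subgroup G}
    (hN : N.Normal)
    (hcf : ∀ H K : Subgroup G, IsChiefFactor G H K → H ≤ N → ⁅commutator G, H⁆ ≤ K)
    (hU : HasNilpotentDerivedSubgroup U) :
    HasNilpotentDerivedSubgroup (N ⊔ U : Subgroup G) := by
  rw [hasNilpotentDerivedSubgroup_iff, Subgroup.isNilpotent_iff_lowerCentralSeries] at hU ⊢
  obtain ⟨n, hn⟩ := hU
  refine exists_lowerCentralSeries_eq_bot (Subgroup.commutator_mono le_top le_top) N hN hcf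
    (n := n) ?_
  have hmap : (N ⊔ U).map (QuotientGroup.mk' N) = U.map (QuotientGroup.mk' N) := by
    rw [Subgroup.map_sup, QuotientGroup.map_mk'_self, bot_sup_eq]
  refine le_of_le_of_eq ?_ (QuotientGroup.ker_mk' N)
  rw [← Subgroup.map_eq_bot_iff, Subgroup.map_lowerCentralSeries, Subgroup.map_commutator, hmap, ← Subgroup.map_commutator, ← Subgroup.map_lowerCentralSeries,
    hn, Subgroup.map_bot]

/-- If every maximal subgroup with nilpotent derived subgroup contains `H`, then the derived
subgroup of `G` centralizes each chief factor `H/K`. -/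
theorem commutator_le_of_isChiefFactor {G : Type*} [Group G] [Finite G] {H K : Subgroup G}
    (hcf : IsChiefFactor G H K)
    (hH : ∀ U : Subgroup G, IsMaximalNilpotentDerived U → H ≤ U) :
    ⁅commutator G, H⁆ ≤ K := by
  have hKn := hcf.normalK
  have hHn := hcf.normalH
  set π := QuotientGroup.mk' K with hπ
  have hπs : Function.Surjective π := QuotientGroup.mk'_surjective K
  have hker : π.ker = K := QuotientGroup.ker_mk' K
  set N := H.map π with hNdef
  have hNn : N.Normal := hHn.map π hπs
  have hbot : N ≠ ⊥ := by
    rw [Ne, hNdef, Subgroup.map_eq_bot_iff, hker]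
    exact hcf.lt.not_ge
  have hmin : ∀ L : Subgroup (G ⧸ K), L.Normal → L ≤ N → L = ⊥ ∨ L = N := by
    intro L hL hLN
    have hLmap : (L.comap π).map π = L := Subgroup.map_comap_eq_self_of_surjective hπs L
    have hle : L.comap π ≤ H := by
      refine (Subgroup.comap_mono hLN).trans ?_
      rw [hNdef, Subgroup.comap_map_eq, hker, sup_eq_left.2 hcf.lt.le]
    have hge : K ≤ L.comap π := hker.symm.le.trans (Subgroup.ker_le_comap π L)
    refine (hcf.step _ (hL.comap π) hge hle).imp (fun h => ?_) fun h => ?_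
    · rw [← hLmap, h, hπ, QuotientGroup.map_mk'_self]
    · rw [← hLmap, h]
  have hsol : Group.IsSolvable N := by
    obtain ⟨W, hW, -⟩ := exists_isMaximalNilpotentDerived_ge
      (hasNilpotentDerivedSubgroup_bot G)
    have hWs : Group.IsSolvable W := isSolvable_of_isNilpotent_commutator hW.1
    have hHs : Group.IsSolvable H := Group.isSolvable_of_isSolvable_injective
      (Subgroup.inclusion_injective (hH W hW))
    exact Group.isSolvable_of_surjective (π.subgroupMap_surjective H)
  obtain ⟨p, hp, hNp⟩ := exists_isPGroup_of_minimal_normal hbot hmin hsol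
  set φ : G →* MulAut N := MulAut.conjNormal.comp π with hφ
  have hpG : IsPGroup p ((⁅(⊤ : Subgroup G), ⊤⁆ : Subgroup G).map φ) := by
    by_contra hnot
    obtain ⟨U, hU, hUp⟩ := exists_isNilpotent_commutator_not_isPGroup hp φ hnot
    obtain ⟨W, hW, hUW⟩ := exists_isMaximalNilpotentDerived_ge hU
    refine hUp (IsPGroup.to_le ?_ (Subgroup.map_mono (Subgroup.commutator_mono hUW hUW)))
    rw [hφ, ← Subgroup.map_map, Subgroup.map_commutator]
    refine isPGroup_map_conjNormal_of_isNilpotent hp hNp (Subgroup.map_mono (hH W hW)) ?_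
    refine hasNilpotentDerivedSubgroup_iff.2 ?_
    rw [← Subgroup.map_commutator]
    exact isNilpotent_subgroup_map (hasNilpotentDerivedSubgroup_iff.1 hW.1) π
  rw [hφ, ← Subgroup.map_map, ← commutator_def] at hpG
  have hT : ((commutator G).map π).Normal := Subgroup.Normal.map inferInstance π hπs
  have hcent := le_centralizer_of_isPGroup_map_conjNormal hp hbot hmin hNp hpG
  rw [← Subgroup.commutator_eq_bot_iff_le_centralizer, Subgroup.commutator_comm, hNdef,
    ← Subgroup.map_commutator, Subgroup.map_eq_bot_iff, hker] at hcent
  exact hcent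

theorem IsMaximalNilpotentDerived.comap_mulEquiv {G : Type*} [Group G] (e : G ≃* G)
    {U : Subgroup G} (hU : IsMaximalNilpotentDerived U) :
    IsMaximalNilpotentDerived (U.comap e.toMonoidHom) := by
  have hmap : ∀ (f : G ≃* G) {V : Subgroup G}, HasNilpotentDerivedSubgroup V →
      HasNilpotentDerivedSubgroup (V.map f.toMonoidHom) := by
    intro f V hV
    rw [hasNilpotentDerivedSubgroup_iff] at hV ⊢
    rw [← Subgroup.map_commutator]
    exact isNilpotent_subgroup_map hV _
  refine ⟨?_, fun V hV hVn => ?_⟩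
  · rw [Subgroup.comap_equiv_eq_map_symm']
    exact hmap e.symm hU.1
  · have := hU.2 (V.map e.toMonoidHom) ?_ (hmap e hVn)
    · rw [this]
      exact Subgroup.comap_map_eq_self_of_injective e.injective V
    · rw [← Subgroup.map_comap_eq_self_of_surjective (f := e.toMonoidHom) e.surjective U]
      exact Subgroup.map_mono hV

/-- Let `D` be the intersection of all maximal subgroups of a finite group `G` among the
subgroups with nilpotent derived subgroup.  Then `D` is normal in `G`, `D` has nilpotent
derived subgroup, `G/C_G(H/K)` is abelian for every chief factor `H/K` of `G` below `D`,
and `D` contains every normal subgroup `N` of `G` with these same properties;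
thus `D` is the largest such normal subgroup of `G`. -/
theorem intersection_maximal_nilpotentDerived
    (G : Type*) [Group G] [Finite G] (D : Subgroup G)
    (hD : D = ⨅ U ∈ {U : Subgroup G | IsMaximalNilpotentDerived U}, U) :
    D.Normal ∧ HasNilpotentDerivedSubgroup D ∧
    (∀ H K : Subgroup G, ∀ hcf : IsChiefFactor G H K, H ≤ D →
      letI := chiefCentralizer_normal G H K hcf.normalH hcf.normalK
      ∀ x y : G ⧸ chiefCentralizer G H K hcf.normalH hcf.normalK, x * y = y * x) ∧
    ∀ N : Subgroup G, N.Normal → HasNilpotentDerivedSubgroup N →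
      (∀ H K : Subgroup G, ∀ hcf : IsChiefFactor G H K, H ≤ N →
        letI := chiefCentralizer_normal G H K hcf.normalH hcf.normalK
        ∀ x y : G ⧸ chiefCentralizer G H K hcf.normalH hcf.normalK, x * y = y * x) →
      N ≤ D := by
  have hDle : ∀ U : Subgroup G, IsMaximalNilpotentDerived U → D ≤ U := fun U hU =>
    hD ▸ iInf₂_le U hU
  have hleD : ∀ N : Subgroup G, (∀ U : Subgroup G, IsMaximalNilpotentDerived U → N ≤ U) → N ≤ D :=
    fun N hN => hD ▸ le_iInf₂ hN
  refine ⟨?_, ?_, fun H K hcf hHD => ?_, fun N hN _ hcf => hleD N fun U hU => ?_⟩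
  · refine ⟨fun x hx g => ?_⟩
    refine hleD (D.map (MulAut.conj g).toMonoidHom) (fun U hU => ?_) ⟨x, hx, rfl⟩
    rw [Subgroup.map_le_iff_le_comap]
    exact hDle _ (hU.comap_mulEquiv _)
  · obtain ⟨W, hW, -⟩ := exists_isMaximalNilpotentDerived_ge
      (hasNilpotentDerivedSubgroup_bot G)
    have hDW := hDle W hW
    exact hasNilpotentDerivedSubgroup_iff.2 (isNilpotent_subgroup_of_le
      (Subgroup.commutator_mono hDW hDW) (hasNilpotentDerivedSubgroup_iff.1 hW.1))
  · exact (quotient_chiefCentralizer_comm_iff hcf.normalH hcf.normalK).2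
      (commutator_le_of_isChiefFactor hcf fun U hU => hHD.trans (hDle U hU))
  · have hsup := hasNilpotentDerivedSubgroup_sup hN
      (fun H K h hle => (quotient_chiefCentralizer_comm_iff h.normalH h.normalK).1 (hcf H K h hle))
      hU.1
    exact le_sup_left.trans (hU.2 _ le_sup_right hsup).ge
end

section
/- Let G be a finite group and let D be the intersection of all maximal metanilpotent subgroups of G. Then D is a normal subgroup of G, D is metanilpotent, every chief factor H/K of G below D satisfies that G/C_G(H/K) is nilpotent, and D contains every normal subgroup N of G such that N is metanilpotent and G/C_G(H/K) is nilpotent for every chief factor H/K of G below N. Thus D is the largest such normal subgroup of G. -/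
/-- A finite group is metanilpotent if it has a nilpotent normal subgroup with nilpotent
quotient. -/
def IsMetanilpotent (X : Type*) [Group X] : Prop :=
  ∃ N : Subgroup X, ∃ hn : N.Normal, Group.IsNilpotent N ∧
    (letI := hn
     Group.IsNilpotent (X ⧸ N))

/-- `U` is a maximal metanilpotent subgroup of `G`. -/
def IsMaximalMetanilpotent {G : Type*} [Group G] (U : Subgroup G) : Prop :=
  IsMetanilpotent U ∧ ∀ V : Subgroup G, U ≤ V → IsMetanilpotent V → U = V

section

open Subgroup

section Metanilpotent

variable {G : Type*} [Group G]

theorem isNilpotent_quotient_iff (A : Subgroup G) [A.Normal] :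
    Group.IsNilpotent (G ⧸ A) ↔ ∃ n, (⊤ : Subgroup G).lowerCentralSeries n ≤ A := by
  rw [Subgroup.nilpotent_iff_lowerCentralSeries]
  refine exists_congr fun n => ?_
  rw [← map_top_of_surjective _ (QuotientGroup.mk'_surjective A), ← map_lowerCentralSeries,
    Subgroup.map_eq_bot_iff, QuotientGroup.ker_mk']

theorem isMetanilpotent_iff (M : Subgroup G) :
    IsMetanilpotent M ↔ ∃ n k, (M.lowerCentralSeries n).lowerCentralSeries k = ⊥ := by
  constructor
  · rintro ⟨N, hN, hNn, hq⟩
    obtain ⟨n, hn⟩ := (isNilpotent_quotient_iff N).1 hq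
    obtain ⟨k, hk⟩ := (isNilpotent_iff_lowerCentralSeries N).1 hNn
    refine ⟨n, k, ?_⟩
    rw [← top_subtype_lowerCentralSeries M, ← map_lowerCentralSeries, Subgroup.map_eq_bot_iff]
    exact ((Subgroup.lowerCentralSeries_mono k hn).trans hk.le).trans bot_le
  · rintro ⟨n, k, h⟩
    refine ⟨(⊤ : Subgroup M).lowerCentralSeries n, inferInstance, ?_,
      (isNilpotent_quotient_iff _).2 ⟨n, le_rfl⟩⟩
    refine (isNilpotent_iff_lowerCentralSeries _).2 ⟨k, ?_⟩
    rw [← map_subtype_inj, Subgroup.map_bot, map_lowerCentralSeries,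
      top_subtype_lowerCentralSeries, h]

theorem IsMetanilpotent.mono {M N : Subgroup G} (hN : IsMetanilpotent N) (h : M ≤ N) :
    IsMetanilpotent M := by
  rw [isMetanilpotent_iff] at *
  obtain ⟨n, k, hk⟩ := hN
  exact ⟨n, k, le_bot_iff.1 <|
    (Subgroup.lowerCentralSeries_mono k (Subgroup.lowerCentralSeries_mono n h)).trans hk.le⟩

theorem IsMetanilpotent.map {G' : Type*} [Group G'] {M : Subgroup G} (hM : IsMetanilpotent M)
    (f : G →* G') : IsMetanilpotent (M.map f) := by
  rw [isMetanilpotent_iff] at *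
  obtain ⟨n, k, hk⟩ := hM
  exact ⟨n, k, by rw [← map_lowerCentralSeries, ← map_lowerCentralSeries, hk, Subgroup.map_bot]⟩

theorem IsMetanilpotent.isSolvable {X : Type*} [Group X] (h : IsMetanilpotent X) :
    Group.IsSolvable X := by
  obtain ⟨N, hN, hNn, hq⟩ := h
  have : Group.IsSolvable (X ⧸ N) := inferInstance
  exact Group.isSolvable_of_ker_le_range N.subtype (QuotientGroup.mk' N) (by simp)

theorem isMetanilpotent_bot : IsMetanilpotent (⊥ : Subgroup G) :=
  (isMetanilpotent_iff _).2 ⟨0, 0, rfl⟩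

theorem IsMetanilpotent.exists_le_isMaximalMetanilpotent [Finite G] {U : Subgroup G}
    (hU : IsMetanilpotent U) : ∃ M : Subgroup G, U ≤ M ∧ IsMaximalMetanilpotent M := by
  obtain ⟨M, hUM, hM⟩ :=
    (Set.toFinite {V : Subgroup G | IsMetanilpotent V}).exists_le_maximal hU
  exact ⟨M, hUM, hM.prop, fun V hV hVm => le_antisymm hV (hM.le_of_ge hVm hV)⟩

theorem IsMaximalMetanilpotent.map_mulEquiv {U : Subgroup G} (hU : IsMaximalMetanilpotent U)
    (e : G ≃* G) : IsMaximalMetanilpotent (U.map e.toMonoidHom) := by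
  refine ⟨hU.1.map _, fun V hV hVm => ?_⟩
  have h := hU.2 (V.map e.symm.toMonoidHom) ?_ (hVm.map _)
  · rw [h, map_map]
    ext; simp
  · have := map_mono (f := e.symm.toMonoidHom) hV
    rw [map_map] at this
    simpa using this

theorem normal_iInf_isMaximalMetanilpotent :
    (⨅ U ∈ {U : Subgroup G | IsMaximalMetanilpotent U}, U).Normal := by
  constructor
  intro x hx g
  simp only [mem_iInf, Set.mem_ofPred_eq] at hx ⊢
  intro U hU
  obtain ⟨y, hy, rfl⟩ := hx _ (hU.map_mulEquiv (MulAut.conj g⁻¹))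
  convert hy using 1
  simp [mul_assoc]

end Metanilpotent

section NormalSubgroup

variable {G : Type*} [Group G]

theorem exists_iterate_commutator_eq_bot [Finite G] {N R : Subgroup G}
    (hR : ∀ H K : Subgroup G, ∀ hcf : IsChiefFactor G H K, H ≤ N →
      R ≤ chiefCentralizer G H K hcf.normalH hcf.normalK)
    (L : Subgroup G) (hL : L.Normal) (hLN : L ≤ N) :
    ∃ m, (fun X : Subgroup G => ⁅X, R⁆)^[m] L = ⊥ := by
  have hmono : ∀ m, Monotone (fun X : Subgroup G => ⁅X, R⁆)^[m] := fun m =>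
    Monotone.iterate (fun X Y h => commutator_mono h le_rfl) m
  induction L using WellFoundedLT.induction with
  | ind L ih =>
    by_cases hbot : L = ⊥
    · exact ⟨0, hbot⟩
    obtain ⟨K, -, hK⟩ := (Set.toFinite {K : Subgroup G | K.Normal ∧ K < L}).exists_le_maximal
      (a := ⊥) ⟨inferInstance, bot_lt_iff_ne_bot.2 hbot⟩
    have hcf : IsChiefFactor G L K := by
      refine ⟨hL, hK.prop.1, hK.prop.2, fun X hX hKX hXL => ?_⟩
      by_contra! h
      exact h.1 (le_antisymm (hK.le_of_ge ⟨hX, lt_of_le_of_ne hXL h.2⟩ hKX) hKX)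
    obtain ⟨m, hm⟩ := ih K hK.prop.2 hK.prop.1 (hK.prop.2.le.trans hLN)
    refine ⟨m + 1, le_bot_iff.1 (le_trans ?_ hm.le)⟩
    rw [Function.iterate_succ_apply]
    refine hmono m ?_
    rw [commutator_comm, commutator_le]
    exact fun r hr h hh => hR L K hcf hLN hr h hh

theorem isMetanilpotent_sup [Finite G] {N U : Subgroup G} [hN : N.Normal]
    (hcf : ∀ H K : Subgroup G, ∀ hcf : IsChiefFactor G H K, H ≤ N →
      letI := chiefCentralizer_normal G H K hcf.normalH hcf.normalK
      Group.IsNilpotent (G ⧸ chiefCentralizer G H K hcf.normalH hcf.normalK))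
    (hU : IsMetanilpotent U) : IsMetanilpotent (U ⊔ N : Subgroup G) := by
  obtain ⟨a, ha⟩ : ∃ a, ∀ n, a ≤ n → (⊤ : Subgroup G).lowerCentralSeries a =
      (⊤ : Subgroup G).lowerCentralSeries n := by
    obtain ⟨a, ha⟩ := WellFoundedGT.monotone_chain_condition (α := (Subgroup G)ᵒᵈ)
      ⟨fun n => OrderDual.toDual ((⊤ : Subgroup G).lowerCentralSeries n),
        fun i j h => Subgroup.lowerCentralSeries_antitone _ h⟩
    exact ⟨a, ha⟩
  obtain ⟨m, hm⟩ := exists_iterate_commutator_eq_bot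
    (R := (⊤ : Subgroup G).lowerCentralSeries a) (fun H K h hHN => by
      have := chiefCentralizer_normal G H K h.normalH h.normalK
      obtain ⟨n, hn⟩ := (isNilpotent_quotient_iff _).1 (hcf H K h hHN)
      rw [ha _ (le_max_left a n)]
      exact (Subgroup.lowerCentralSeries_antitone _ (le_max_right a n)).trans hn) N hN le_rfl
  obtain ⟨n, k, hk⟩ := (isMetanilpotent_iff U).1 hU
  set R := (U ⊔ N).lowerCentralSeries (max a n)
  have hRa : R ≤ (⊤ : Subgroup G).lowerCentralSeries a :=
    (Subgroup.lowerCentralSeries_mono _ le_top).trans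
      (Subgroup.lowerCentralSeries_antitone _ (le_max_left a n))
  have hRN : R.lowerCentralSeries k ≤ N := by
    rw [← QuotientGroup.ker_mk' N, ← Subgroup.map_eq_bot_iff, map_lowerCentralSeries,
      map_lowerCentralSeries, Subgroup.map_sup, QuotientGroup.map_mk'_self, sup_bot_eq,
      ← map_lowerCentralSeries, ← map_lowerCentralSeries, Subgroup.map_eq_bot_iff]
    refine le_trans ?_ (hk.le.trans bot_le)
    exact Subgroup.lowerCentralSeries_mono k
      (Subgroup.lowerCentralSeries_antitone _ (le_max_right a n))
  have hit : ∀ j, R.lowerCentralSeries (k + j) ≤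
      (fun X : Subgroup G => ⁅X, (⊤ : Subgroup G).lowerCentralSeries a⁆)^[j] N := by
    intro j
    induction j with
    | zero => exact hRN
    | succ j ih =>
      rw [← add_assoc, Subgroup.lowerCentralSeries_succ, Function.iterate_succ_apply']
      exact commutator_mono ih hRa
  exact (isMetanilpotent_iff _).2 ⟨max a n, k + m, le_bot_iff.1 ((hit m).trans hm.le)⟩

end NormalSubgroup

section Fusion

open scoped commutatorElement

variable {G : Type*} [Group G] {q : ℕ}

theorem eq_bot_of_le_commutator {H : Subgroup G} (hH : Group.IsSolvable H) (h : H ≤ ⁅H, H⁆) :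
    H = ⊥ := by
  by_contra hne
  have : Nontrivial H := (nontrivial_iff_ne_bot _).2 hne
  refine (Group.IsSolvable.commutator_lt_top_of_nontrivial H).not_ge ?_
  rwa [← map_subtype_le_map_subtype, map_subtype_commutator, ← MonoidHom.range_eq_map,
    range_subtype]

theorem exists_coprime_orderOf_pow_pow [Finite G] [Fact q.Prime] (g : G) :
    ∃ k, (orderOf (g ^ q ^ k)).Coprime q := by
  obtain ⟨k, m, hm, hk⟩ :=
    Nat.exists_eq_pow_mul_and_not_dvd (orderOf_pos g).ne' q (Fact.out : q.Prime).ne_one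
  refine ⟨k, ?_⟩
  rw [orderOf_pow_of_dvd (pow_ne_zero _ (Fact.out : q.Prime).ne_zero) (hk ▸ dvd_mul_right _ _),
    hk, Nat.mul_div_cancel_left _ (pow_pos (Fact.out : q.Prime).pos _)]
  exact ((Nat.Prime.coprime_iff_not_dvd Fact.out).2 hm).symm

theorem sylow_sup_eq_top_of_isPGroup_quotient [Finite G] [Fact q.Prime] {C : Subgroup G} [C.Normal]
    (hC : IsPGroup q (G ⧸ C)) (S : Sylow q G) : (S : Subgroup G) ⊔ C = ⊤ := by
  obtain ⟨n, hn⟩ := IsPGroup.iff_card.1 hC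
  rw [← index_eq_one]
  have h1 : ((S : Subgroup G) ⊔ C).index ∣ q ^ n := hn ▸ index_dvd_of_le le_sup_right
  obtain ⟨k, -, hk⟩ := (Nat.dvd_prime_pow Fact.out).1 h1
  have h2 : ((S : Subgroup G) ⊔ C).index ∣ (S : Subgroup G).index := index_dvd_of_le le_sup_left
  rcases k with _ | k
  · simpa using hk
  · exact absurd ((dvd_pow_self q k.succ_ne_zero).trans (hk ▸ h2)) S.not_dvd_index

theorem exists_mem_smul_eq_of_isPGroup_quotient [Finite G] [Fact q.Prime] {C : Subgroup G}
    [C.Normal] (hC : IsPGroup q (G ⧸ C)) (S T : Sylow q G) : ∃ c ∈ C, c • S = T := by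
  obtain ⟨g, rfl⟩ := MulAction.exists_smul_eq G S T
  obtain ⟨s, hs, c, hc, rfl⟩ := mem_sup_of_normal_right.1
    ((sylow_sup_eq_top_of_isPGroup_quotient hC S).symm ▸ mem_top g)
  refine ⟨s * c * s⁻¹, ‹C.Normal›.conj_mem c hc s, ?_⟩
  have hs' : s • S = S := Sylow.smul_eq_iff_mem_normalizer.2 (le_normalizer hs)
  nth_rw 1 [← hs']
  rw [smul_smul, inv_mul_cancel_right]

/-- Every element of order prime to `q` which normalizes a `q`-subgroup centralizes it. -/
def CentralizesNormalizedPSubgroups (q : ℕ) (G : Type*) [Group G] : Prop :=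
  ∀ Q : Subgroup G, IsPGroup q Q → ∀ x ∈ normalizer (Q : Set G), (orderOf x).Coprime q →
    ∀ u ∈ Q, x * u = u * x

theorem CentralizesNormalizedPSubgroups.subgroup (h : CentralizesNormalizedPSubgroups q G)
    (H : Subgroup G) : CentralizesNormalizedPSubgroups q H := by
  intro Q hQ x hx hxq u hu
  have := h (Q.map H.subtype) (hQ.map _) x (le_normalizer_map H.subtype (mem_map_of_mem _ hx))
    (by simpa using hxq) u (mem_map_of_mem _ hu)
  exact Subtype.ext this

theorem CentralizesNormalizedPSubgroups.isPGroup_quotient_ker [Finite G] [Fact q.Prime]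
    (h : CentralizesNormalizedPSubgroups q G) {I : Subgroup G} (hI : IsPGroup q I) :
    IsPGroup q (normalizer (I : Set G) ⧸ I.normalizerMonoidHom.ker) := by
  intro g
  induction g using QuotientGroup.induction_on with
  | H g =>
    obtain ⟨k, hk⟩ := exists_coprime_orderOf_pow_pow (q := q) g
    refine ⟨k, ?_⟩
    rw [← QuotientGroup.mk_pow, QuotientGroup.eq_one_iff, normalizerMonoidHom_ker,
      mem_subgroupOf, mem_centralizer_iff]
    intro u hu
    exact (h I hI _ (g ^ q ^ k).2 (by rwa [orderOf_coe]) u hu).symm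

theorem lt_normalizer_inf_of_isPGroup [Finite G] [Fact q.Prime] {I S : Subgroup G}
    (hS : IsPGroup q S) (h : I < S) : I < normalizer (I : Set G) ⊓ S := by
  refine lt_of_le_of_ne (le_inf le_normalizer h.le) fun he => ?_
  have : Group.IsNilpotent S := hS.isNilpotent
  have hlt := Group.normalizerCondition_of_isNilpotent (I.subgroupOf S)
    (lt_top_iff_ne_top.2 fun ht => h.not_ge (subgroupOf_eq_top.1 ht))
  rw [← subgroupOf_normalizer_eq h.le, ← inf_subgroupOf_right (normalizer (I : Set G)), ← he] at hlt
  exact lt_irrefl _ hlt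

theorem CentralizesNormalizedPSubgroups.exists_mem_centralizer_smul_eq [Finite G] [Fact q.Prime]
    (h : CentralizesNormalizedPSubgroups q G) (S T : Sylow q G) :
    ∃ c ∈ centralizer (((S : Subgroup G) ⊓ T : Subgroup G) : Set G), c • S = T := by
  obtain ⟨I, hI⟩ : ∃ I : Subgroup G, I = (S : Subgroup G) ⊓ T := ⟨_, rfl⟩
  rw [← hI]
  induction I using WellFoundedGT.induction generalizing S T with
  | ind I ih =>
    by_cases hST : (S : Subgroup G) ≤ T
    · exact ⟨1, one_mem _, by rw [one_smul]; exact Sylow.ext (S.is_maximal' T.2 hST).symm⟩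
    have hIS : I < S := lt_of_le_of_ne (hI ▸ inf_le_left) fun he => hST (he ▸ hI ▸ inf_le_right)
    have hIT : I < T := by
      refine lt_of_le_of_ne (hI ▸ inf_le_right) fun he => hST ?_
      exact (T.is_maximal' S.2 (he ▸ hI ▸ inf_le_left)).le
    have hIp : IsPGroup q I := S.2.to_le hIS.le
    obtain ⟨S₁, hS₁⟩ := IsPGroup.exists_le_sylow
      (S.2.comap_of_injective (normalizer (I : Set G)).subtype Subtype.val_injective)
    obtain ⟨T₁, hT₁⟩ := IsPGroup.exists_le_sylow
      (T.2.comap_of_injective (normalizer (I : Set G)).subtype Subtype.val_injective)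
    obtain ⟨c₀, hc₀, rfl⟩ :=
      exists_mem_smul_eq_of_isPGroup_quotient (h.isPGroup_quotient_ker hIp) S₁ T₁
    rw [normalizerMonoidHom_ker, mem_subgroupOf] at hc₀
    obtain ⟨R, hR⟩ := (S₁.2.map (normalizer (I : Set G)).subtype).exists_le_sylow
    have hR' : ∀ x (hx : x ∈ normalizer (I : Set G)), ⟨x, hx⟩ ∈ S₁ → x ∈ R :=
      fun x hx hxS => hR (mem_map_of_mem (normalizer (I : Set G)).subtype hxS)
    have h₁ : I < (S : Subgroup G) ⊓ R :=
      (lt_normalizer_inf_of_isPGroup S.2 hIS).trans_le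
        fun x hx => ⟨hx.2, hR' x hx.1 (hS₁ hx.2)⟩
    have h₂ : I < (((c₀ : G) • R : Sylow q G) : Subgroup G) ⊓ (T : Subgroup G) := by
      refine (lt_normalizer_inf_of_isPGroup T.2 hIT).trans_le fun x hx => ⟨?_, hx.2⟩
      have hxT : (⟨x, hx.1⟩ : normalizer (I : Set G)) ∈ (c₀ • S₁ : Sylow q _).toSubgroup :=
        hT₁ hx.2
      rw [Sylow.coe_subgroup_smul, mem_pointwise_smul_iff_inv_smul_mem] at hxT
      change x ∈ ((c₀ : G) • R : Sylow q G).toSubgroup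
      rw [Sylow.coe_subgroup_smul, mem_pointwise_smul_iff_inv_smul_mem]
      rw [← map_inv] at hxT ⊢
      have hxR := hR' _ (c₀⁻¹ * ⟨x, hx.1⟩ * c₀⁻¹⁻¹ : normalizer (I : Set G)).2 hxT
      exact hxR
    obtain ⟨c₁, hc₁, hc₁'⟩ := ih _ h₁ S R rfl
    obtain ⟨c₂, hc₂, hc₂'⟩ := ih _ h₂ _ T rfl
    refine ⟨c₂ * c₀ * c₁, mul_mem (mul_mem (centralizer_le h₂.le hc₂) hc₀)
      (centralizer_le h₁.le hc₁), ?_⟩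
    rw [mul_smul, mul_smul, hc₁', hc₂']

theorem CentralizesNormalizedPSubgroups.exists_conj_eq [Finite G] [Fact q.Prime]
    (h : CentralizesNormalizedPSubgroups q G) (S : Sylow q G) {x u : G} (hx : x ∈ S)
    (hux : u * x * u⁻¹ ∈ S) : ∃ s ∈ S, u * x * u⁻¹ = s * x * s⁻¹ := by
  obtain ⟨c, hc, hcS⟩ := h.exists_mem_centralizer_smul_eq (u • S) S
  have hcx : u * x * u⁻¹ * c = c * (u * x * u⁻¹) := by
    refine mem_centralizer_iff.1 hc _ ⟨?_, hux⟩
    change _ ∈ (u • S : Sylow q G).toSubgroup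
    rw [Sylow.coe_subgroup_smul]
    exact smul_mem_pointwise_smul x (MulAut.conj u) (S : Subgroup G) hx
  rw [smul_smul, Sylow.smul_eq_iff_mem_normalizer] at hcS
  obtain ⟨s, hs, k, hk, hsk⟩ := mem_sup_of_normal_right.1
    ((sylow_sup_eq_top_of_isPGroup_quotient (h.isPGroup_quotient_ker S.2)
      (S.subtype le_normalizer)).symm ▸ mem_top (⟨c * u, hcS⟩ : normalizer (S : Set G)))
  rw [normalizerMonoidHom_ker, mem_subgroupOf, mem_centralizer_iff] at hk
  have hkx : x * k = k * x := hk x hx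
  have hsk' : (s : G) * k = c * u := congrArg Subtype.val hsk
  refine ⟨s, hs, ?_⟩
  calc u * x * u⁻¹ = u * x * u⁻¹ * c * c⁻¹ := by group
    _ = c * u * x * (c * u)⁻¹ := by rw [hcx]; group
    _ = s * (k * x) * (k : G)⁻¹ * (s : G)⁻¹ := by rw [← hsk']; group
    _ = s * x * (s : G)⁻¹ := by rw [← hkx]; group

theorem CentralizesNormalizedPSubgroups.focalSubgroup_le [Finite G] [Fact q.Prime]
    (h : CentralizesNormalizedPSubgroups q G) (S : Sylow q G) :
    (S : Subgroup G).focalSubgroup ≤ ⁅(S : Subgroup G), (S : Subgroup G)⁆ := by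
  rw [focalSubgroup_def, closure_le]
  rintro _ ⟨hg, x, hx, u, rfl⟩
  have hux : u * x * u⁻¹ ∈ S := by
    have := mul_mem (inv_mem hg) hx
    rw [commutatorElement_def] at this
    have e : u * x * u⁻¹ = (x * u * x⁻¹ * u⁻¹)⁻¹ * x := by group
    rwa [e]
  obtain ⟨s, hs, hsx⟩ := h.exists_conj_eq S hx hux
  have hxs : ⁅x, u⁆ = ⁅x, s⁆ := by
    calc ⁅x, u⁆ = x * (u * x * u⁻¹)⁻¹ := by rw [commutatorElement_def]; group
      _ = ⁅x, s⁆ := by rw [hsx, commutatorElement_def]; group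
  rw [SetLike.mem_coe, hxs]
  exact commutator_mem_commutator hx hs

/-- Frobenius' criterion for the existence of a normal `q`-complement. -/
theorem CentralizesNormalizedPSubgroups.exists_subgroup_mem_iff {G : Type*} [Group G] [Finite G]
    [Fact q.Prime] (h : CentralizesNormalizedPSubgroups q G) :
    ∃ N : Subgroup G, ∀ g, g ∈ N ↔ (orderOf g).Coprime q := by
  induction hn : Nat.card G using Nat.strong_induction_on generalizing G with
  | _ n ih =>
    let S : Sylow q G := default
    by_cases hS : (S : Subgroup G) = ⊥
    · refine ⟨⊤, fun g => ⟨fun _ => ?_, fun _ => mem_top g⟩⟩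
      have := S.not_dvd_index
      rw [hS, index_bot] at this
      exact (((Nat.Prime.coprime_iff_not_dvd Fact.out).2 this).symm).coprime_dvd_left
        (orderOf_dvd_natCard g)
    have hK : (S : Subgroup G).transferFocal.ker < ⊤ := by
      refine lt_top_iff_ne_top.2 fun ht => ?_
      have hSf := ker_transferFocal_inf_eq_focalSubgroup S
      rw [ht, top_inf_eq] at hSf
      have : Group.IsNilpotent S := S.2.isNilpotent
      exact hS (eq_bot_of_le_commutator inferInstance (hSf.le.trans (h.focalSubgroup_le S)))
    obtain ⟨N, hN⟩ := ih _ (hn ▸ lt_of_not_ge fun hle => hK.ne (eq_top_of_le_card _ hle))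
      (h.subgroup _) rfl
    refine ⟨N.map (Subgroup.subtype _), fun g => ⟨?_, fun hg => ?_⟩⟩
    · rintro ⟨x, hx, rfl⟩
      rw [subtype_apply, orderOf_coe]
      exact (hN x).1 hx
    · have hgK : g ∈ (S : Subgroup G).transferFocal.ker := by
        rw [MonoidHom.mem_ker, ← orderOf_eq_one_iff]
        obtain ⟨k, hk⟩ := IsPGroup.iff_orderOf.1
          (S.2.to_quotient (S : Subgroup G).focalSubgroupOf) ((S : Subgroup G).transferFocal g)
        have := hg.coprime_dvd_left (orderOf_map_dvd (S : Subgroup G).transferFocal g)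
        exact Nat.Coprime.eq_one_of_dvd (hk ▸ this.pow_right k) hk.dvd
      exact ⟨⟨g, hgK⟩, (hN _).2 (by simpa using hg), rfl⟩

end Fusion

section Lifting

open scoped commutatorElement

variable {G : Type*} [Group G] [Finite G]

theorem isNilpotent_of_centralizesNormalizedPSubgroups {p : ℕ} [Fact p.Prime]
    (h : ∀ q, q.Prime → q ≠ p → CentralizesNormalizedPSubgroups q G)
    (hp : ∀ T : Subgroup G, T.Normal → IsPGroup p T → T = ⊥) : Group.IsNilpotent G := by
  have key : ∀ q, ∃ n, q.Prime → q ≠ p → ∀ g ∈ (⊤ : Subgroup G).lowerCentralSeries n,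
      (orderOf g).Coprime q := by
    intro q
    by_cases hq : q.Prime ∧ q ≠ p
    · have : Fact q.Prime := ⟨hq.1⟩
      obtain ⟨N, hN⟩ := (h q hq.1 hq.2).exists_subgroup_mem_iff
      have hNn : N.Normal := ⟨fun n hn g => (hN _).2 <| by
        have e : orderOf (MulAut.conj g n) = orderOf n := MulEquiv.orderOf_eq _ n
        rw [MulAut.conj_apply] at e
        exact e.symm ▸ (hN n).1 hn⟩
      have hNq : IsPGroup q (G ⧸ N) := by
        intro g
        induction g using QuotientGroup.induction_on with
        | H g =>
          obtain ⟨k, hk⟩ := exists_coprime_orderOf_pow_pow (q := q) g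
          exact ⟨k, by rw [← QuotientGroup.mk_pow, QuotientGroup.eq_one_iff, hN]; exact hk⟩
      obtain ⟨n, hn⟩ := (isNilpotent_quotient_iff N).1 hNq.isNilpotent
      exact ⟨n, fun _ _ g hg => (hN g).1 (hn hg)⟩
    · exact ⟨0, fun h₁ h₂ => absurd ⟨h₁, h₂⟩ hq⟩
  choose f hf using key
  refine Subgroup.nilpotent_iff_lowerCentralSeries.2 ⟨(Nat.card G).primeFactors.sup f,
    hp _ inferInstance (IsPGroup.iff_orderOf.2 fun g =>
      ⟨(orderOf g).primeFactorsList.length, ?_⟩)⟩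
  refine Nat.eq_prime_pow_of_unique_prime_dvd (orderOf_pos g).ne' fun {q} hq hqg => ?_
  rw [← orderOf_coe] at hqg
  by_contra hqp
  have hmem : q ∈ (Nat.card G).primeFactors :=
    Nat.mem_primeFactors.2 ⟨hq, hqg.trans (orderOf_dvd_natCard _), Nat.card_pos.ne'⟩
  have := hf q hq hqp g (Subgroup.lowerCentralSeries_antitone _ (Finset.le_sup hmem) g.2)
  exact hq.one_lt.ne' (Nat.Coprime.eq_one_of_dvd this.symm hqg)

theorem centralizesNormalizedPSubgroups_quotient {q : ℕ} [Fact q.Prime] {C : Subgroup G}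
    [C.Normal]
    (h : ∀ Q : Subgroup G, IsPGroup q Q → ∀ y ∈ normalizer (Q : Set G), (orderOf y).Coprime q →
      ∀ u ∈ Q, ⁅y, u⁆ ∈ C) : CentralizesNormalizedPSubgroups q (G ⧸ C) := by
  intro Q hQ x hx hxq u hu
  obtain ⟨x, rfl⟩ := QuotientGroup.mk'_surjective C x
  obtain ⟨u, rfl⟩ := QuotientGroup.mk'_surjective C u
  let E := Q.comap (QuotientGroup.mk' C)
  have hxE : x ∈ normalizer (E : Set G) :=
    (comap_normalizer_eq_of_surjective Q (QuotientGroup.mk'_surjective C)).le hx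
  have hE : IsPGroup q (E ⧸ C.subgroupOf E) := by
    intro e
    induction e using QuotientGroup.induction_on with
    | H e =>
      obtain ⟨k, hk⟩ := hQ ⟨_, e.2⟩
      refine ⟨k, ?_⟩
      rw [← QuotientGroup.mk_pow, QuotientGroup.eq_one_iff, mem_subgroupOf,
        ← QuotientGroup.eq_one_iff]
      exact congrArg Subtype.val hk
  let S : Sylow q E := default
  obtain ⟨c, hc, hcS⟩ := exists_mem_smul_eq_of_isPGroup_quotient hE
    (E.normalizerMonoidHom ⟨x, hxE⟩ • S) S
  rw [mem_subgroupOf] at hc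
  have hmem : ∀ e ∈ S, c * (E.normalizerMonoidHom ⟨x, hxE⟩ e) * c⁻¹ ∈ S := by
    intro e he
    have h₁ : E.normalizerMonoidHom ⟨x, hxE⟩ e ∈
        (E.normalizerMonoidHom ⟨x, hxE⟩ • S : Sylow q E).toSubgroup :=
      smul_mem_pointwise_smul e (E.normalizerMonoidHom ⟨x, hxE⟩) (S : Subgroup E) he
    have h₂ := smul_mem_pointwise_smul _ (MulAut.conj c) _ h₁
    rw [← Sylow.coe_subgroup_smul, hcS] at h₂
    exact h₂
  have hcx : (c : G) * x ∈ normalizer ((S : Subgroup E).map E.subtype : Set G) := by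
    refine mem_normalizer_fintype ?_
    rintro _ ⟨e, he, rfl⟩
    refine ⟨_, hmem e he, ?_⟩
    change (c : G) * (x * e * x⁻¹) * (c : G)⁻¹ = c * x * e * (c * x)⁻¹
    group
  have hcx' : QuotientGroup.mk' C ((c : G) * x) = QuotientGroup.mk' C x := by
    have hc₁ : QuotientGroup.mk' C c = 1 := (QuotientGroup.eq_one_iff _).2 hc
    rw [map_mul, hc₁, one_mul]
  obtain ⟨k, hk⟩ := exists_coprime_orderOf_pow_pow (q := q) ((c : G) * x)
  obtain ⟨m, hm⟩ := exists_pow_eq_self_of_coprime (hxq.symm.pow_left k)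
  have hu' : u ∈ E := hu
  obtain ⟨s, hs, d, hd, hsd⟩ := mem_sup_of_normal_right.1
    ((sylow_sup_eq_top_of_isPGroup_quotient hE S).symm ▸ mem_top (⟨u, hu'⟩ : E))
  have hus : QuotientGroup.mk' C s = QuotientGroup.mk' C u := by
    have hd₁ : QuotientGroup.mk' C d = 1 := (QuotientGroup.eq_one_iff _).2 hd
    have hsd' : (s : G) * d = u := congrArg Subtype.val hsd
    rw [← hsd', map_mul, hd₁, mul_one]
  have hys := h _ (S.2.map E.subtype) _ (pow_mem (pow_mem hcx (q ^ k)) m)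
    (hk.coprime_dvd_left (orderOf_pow_dvd m)) s (mem_map_of_mem _ hs)
  rw [← QuotientGroup.eq_one_iff] at hys
  change QuotientGroup.mk' C _ = 1 at hys
  rwa [map_commutatorElement, map_pow, map_pow, hcx', hm, hus,
    commutatorElement_eq_one_iff_mul_comm] at hys

end Lifting

section NilpotentGroup

open scoped commutatorElement

theorem commute_of_coprime_orderOf {X : Type*} [Group X] [Group.IsNilpotent X] :
    ∀ x y : X, (orderOf x).Coprime (orderOf y) → Commute x y := by
  refine Group.nilpotent_center_quotient_ind
    (P := fun X _ _ => ∀ x y : X, (orderOf x).Coprime (orderOf y) → Commute x y) X ?_ ?_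
  · intro X _ _ x y _
    exact Subsingleton.elim _ _
  · intro X _ _ ih x y hxy
    have hq := ih (QuotientGroup.mk' _ x) (QuotientGroup.mk' _ y)
      ((hxy.coprime_dvd_left (orderOf_map_dvd _ x)).coprime_dvd_right (orderOf_map_dvd _ y))
    have hz : ⁅x, y⁆ ∈ center X := by
      rw [← commutatorElement_eq_one_iff_commute, ← map_commutatorElement] at hq
      exact (QuotientGroup.eq_one_iff _).1 hq
    have hzc : ∀ g, Commute ⁅x, y⁆ g := fun g => (mem_center_iff.1 hz g).symm
    have h₁ : ⁅x, y⁆ ^ orderOf y = 1 := by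
      have : x * y * x⁻¹ = ⁅x, y⁆ * y := by rw [commutatorElement_def]; group
      have h := congrArg (· ^ orderOf y) this
      simpa [conj_pow, (hzc y).mul_pow, pow_orderOf_eq_one] using h.symm
    have h₂ : ⁅x, y⁆ ^ orderOf x = 1 := by
      have : y * x⁻¹ * y⁻¹ = ⁅x, y⁆ * x⁻¹ := by rw [(hzc _).eq, commutatorElement_def]; group
      have h := congrArg (· ^ orderOf x) this
      simpa [conj_pow, (hzc x⁻¹).mul_pow, pow_orderOf_eq_one] using h.symm
    rw [← commutatorElement_eq_one_iff_commute, ← orderOf_eq_one_iff]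
    exact Nat.eq_one_of_dvd_coprimes hxy (orderOf_dvd_of_pow_eq_one h₂)
      (orderOf_dvd_of_pow_eq_one h₁)

theorem exists_mul_pow_pow_eq_one {X : Type*} [Group X] [Finite X] [Group.IsNilpotent X] {q : ℕ}
    [Fact q.Prime] {a b : X} {i j : ℕ} (ha : a ^ q ^ i = 1) (hb : b ^ q ^ j = 1) :
    ∃ l, (a * b) ^ q ^ l = 1 := by
  let S : Sylow q X := default
  have hS : (S : Subgroup X).Normal :=
    Sylow.normal_of_normalizerCondition Group.normalizerCondition_of_isNilpotent S
  have := S.unique_of_normal hS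
  have hmem : ∀ (x : X) (i : ℕ), x ^ q ^ i = 1 → x ∈ S := by
    intro x i hx
    have hp : IsPGroup q (zpowers x) := by
      rintro ⟨_, m, rfl⟩
      refine ⟨i, Subtype.ext ?_⟩
      change (x ^ m) ^ q ^ i = 1
      rw [← zpow_natCast, zpow_comm, zpow_natCast, hx, one_zpow]
    obtain ⟨T, hT⟩ := hp.exists_le_sylow
    rw [Subsingleton.elim S T]
    exact hT (mem_zpowers x)
  obtain ⟨l, hl⟩ := S.2 ⟨a * b, mul_mem (hmem a i ha) (hmem b j hb)⟩
  exact ⟨l, congrArg Subtype.val hl⟩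

theorem isMetanilpotent_sup_zpowers {G : Type*} [Group G] {Q : Subgroup G}
    (hQ : Group.IsNilpotent Q) {y : G} (hy : y ∈ normalizer (Q : Set G)) :
    IsMetanilpotent (Q ⊔ zpowers y : Subgroup G) := by
  set N := normalizer (Q : Set G)
  have hU : (Q.subgroupOf N ⊔ zpowers (⟨y, hy⟩ : N)).map N.subtype = Q ⊔ zpowers y := by
    rw [Subgroup.map_sup, map_subgroupOf_eq_of_le le_normalizer, MonoidHom.map_zpowers]
    rfl
  obtain ⟨k, hk⟩ := (isNilpotent_iff_lowerCentralSeries Q).1 hQ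
  have hk' : (Q.subgroupOf N).lowerCentralSeries k = ⊥ := by
    rw [← map_subtype_inj, map_lowerCentralSeries, map_subgroupOf_eq_of_le le_normalizer, hk,
      Subgroup.map_bot]
  rw [← hU]
  refine IsMetanilpotent.map ((isMetanilpotent_iff _).2 ⟨1, k, le_bot_iff.1 <|
    (Subgroup.lowerCentralSeries_mono k ?_).trans hk'.le⟩) _
  have hn : (Q.subgroupOf N).Normal := inferInstance
  refine le_trans ?_ (QuotientGroup.ker_mk' (Q.subgroupOf N)).le
  rw [← Subgroup.map_eq_bot_iff, map_lowerCentralSeries,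
    Subgroup.map_sup, QuotientGroup.map_mk'_self, bot_sup_eq, MonoidHom.map_zpowers,
    Subgroup.lowerCentralSeries_succ, Subgroup.lowerCentralSeries_zero,
    commutator_eq_bot_iff_le_centralizer]
  rintro _ ⟨m, rfl⟩
  rw [mem_centralizer_iff]
  rintro _ ⟨n, rfl⟩
  exact zpow_mul_comm _ _ _

end NilpotentGroup

section ChiefFactor

open scoped commutatorElement

variable {G : Type*} [Group G]

theorem IsMetanilpotent.commutator_commutator_mem [Finite G] {M : Subgroup G}
    (hM : IsMetanilpotent M) {H K : Subgroup G} (hH : H.Normal) (hK : K.Normal) (hHM : H ≤ M)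
    {p q : ℕ} (hp : p.Prime) [Fact q.Prime] (hqp : q ≠ p) (hHp : ∀ h ∈ H, h ^ p ∈ K)
    {y u : G} (hy : y ∈ M) (hu : u ∈ M) (hyq : (orderOf y).Coprime q) {i j : ℕ}
    (huq : u ^ q ^ i = 1) (hyuq : ⁅y, u⁆ ^ q ^ j = 1) {h : G} (hh : h ∈ H) :
    ⁅⁅y, u⁆, h⁆ ∈ K := by
  obtain ⟨A, hA, hAn, hMA⟩ := hM
  lift y to M using hy
  lift u to M using hu
  have hhM : h ∈ M := hHM hh
  have ha : ⁅y, u⁆ ∈ A := by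
    rw [← QuotientGroup.eq_one_iff]
    change QuotientGroup.mk' A _ = 1
    rw [map_commutatorElement, commutatorElement_eq_one_iff_commute]
    refine commute_of_coprime_orderOf _ _ ?_
    refine Nat.Coprime.coprime_dvd_left (orderOf_map_dvd _ y) ?_
    refine Nat.Coprime.coprime_dvd_right (orderOf_map_dvd _ u) ?_
    rw [orderOf_coe] at hyq
    refine (hyq.pow_right i).coprime_dvd_right (orderOf_dvd_of_pow_eq_one ?_)
    exact_mod_cast huq
  have ha' : (⟨h, hhM⟩ : M) * ⁅y, u⁆⁻¹ * (⟨h, hhM⟩ : M)⁻¹ ∈ A := hA.conj_mem _ (inv_mem ha) _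
  have hyuq' : ⁅y, u⁆ ^ q ^ j = 1 := Subtype.ext hyuq
  obtain ⟨l, hl⟩ := exists_mul_pow_pow_eq_one (q := q) (i := j) (j := j)
    (a := (⟨_, ha⟩ : A)) (b := (⟨_, ha'⟩ : A)) (Subtype.ext hyuq')
    (Subtype.ext (by
      change ((⟨h, hhM⟩ : M) * ⁅y, u⁆⁻¹ * (⟨h, hhM⟩ : M)⁻¹) ^ q ^ j = 1
      rw [conj_pow, inv_pow, hyuq', inv_one, mul_one, mul_inv_cancel]))
  set a : G := ⁅(y : G), (u : G)⁆
  have hw : ⁅a, h⁆ ^ q ^ l = 1 := by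
    have := congrArg (fun x : A => ((x : M) : G)) hl
    change (a * (h * a⁻¹ * h⁻¹)) ^ q ^ l = 1 at this
    rw [← this, commutatorElement_def]
    group
  have hwH : ⁅a, h⁆ ∈ H := by
    rw [commutatorElement_def]
    exact mul_mem (hH.conj_mem _ hh _) (inv_mem hh)
  rw [← QuotientGroup.eq_one_iff, ← orderOf_eq_one_iff]
  refine Nat.eq_one_of_dvd_coprimes (((Nat.coprime_primes hp Fact.out).2 hqp.symm).pow_right l)
    (orderOf_dvd_of_pow_eq_one ?_) (orderOf_dvd_of_pow_eq_one ?_)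
  · rw [← QuotientGroup.mk_pow, QuotientGroup.eq_one_iff]
    exact hHp _ hwH
  · rw [← QuotientGroup.mk_pow, hw, QuotientGroup.mk_one]

theorem IsChiefFactor.commutator_le {H K : Subgroup G} (h : IsChiefFactor G H K)
    (hH : Group.IsSolvable H) : ⁅H, H⁆ ≤ K := by
  have := h.normalH
  have := h.normalK
  rcases h.step (K ⊔ ⁅H, H⁆) inferInstance le_sup_left
    (sup_le h.lt.le (commutator_le_left H H)) with he | he
  · exact he ▸ le_sup_right
  · exfalso
    have hs : Group.IsSolvable (H.map (QuotientGroup.mk' K)) :=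
      Group.isSolvable_of_surjective ((QuotientGroup.mk' K).subgroupMap_surjective H)
    have hb := eq_bot_of_le_commutator hs (by
      rw [← map_commutator]
      conv_lhs => rw [← he, Subgroup.map_sup, QuotientGroup.map_mk'_self, bot_sup_eq])
    rw [Subgroup.map_eq_bot_iff, QuotientGroup.ker_mk'] at hb
    exact h.lt.not_ge hb

theorem IsChiefFactor.exists_prime_pow_mem [Finite G] {H K : Subgroup G}
    (h : IsChiefFactor G H K) (hH : ⁅H, H⁆ ≤ K) :
    ∃ p : ℕ, p.Prime ∧ ∀ x ∈ H, x ^ p ∈ K := by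
  have hHn := h.normalH
  have hKn := h.normalK
  have hcard : Nat.card (H.map (QuotientGroup.mk' K)) ≠ 1 := by
    rw [Ne, card_eq_one, Subgroup.map_eq_bot_iff, QuotientGroup.ker_mk']
    exact h.lt.not_ge
  obtain ⟨p, hp, hpc⟩ := Nat.exists_prime_and_dvd hcard
  have : Fact p.Prime := ⟨hp⟩
  refine ⟨p, hp, ?_⟩
  have hcomm : ∀ x ∈ H, ∀ y ∈ H, Commute (x : G ⧸ K) y := by
    intro x hx y hy
    rw [← commutatorElement_eq_one_iff_commute]
    exact (QuotientGroup.eq_one_iff ⁅x, y⁆).2 (hH (commutator_mem_commutator hx hy))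
  let L : Subgroup G :=
    { carrier := {x | x ∈ H ∧ x ^ p ∈ K}
      one_mem' := ⟨one_mem _, by rw [one_pow]; exact one_mem _⟩
      mul_mem' := by
        rintro x y ⟨hx, hxp⟩ ⟨hy, hyp⟩
        refine ⟨mul_mem hx hy, ?_⟩
        rw [← QuotientGroup.eq_one_iff, QuotientGroup.mk_pow] at hxp hyp ⊢
        rw [QuotientGroup.mk_mul, (hcomm x hx y hy).mul_pow, hxp, hyp, one_mul]
      inv_mem' := by
        rintro x ⟨hx, hxp⟩
        exact ⟨inv_mem hx, by rw [inv_pow]; exact inv_mem hxp⟩ }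
  have hL : L.Normal := ⟨fun x hx g => ⟨hHn.conj_mem _ hx.1 g, by
    rw [conj_pow]; exact hKn.conj_mem _ hx.2 g⟩⟩
  rcases h.step L hL (fun x hx => ⟨h.lt.le hx, pow_mem hx p⟩) (fun x hx => hx.1) with he | he
  · exfalso
    obtain ⟨⟨_, x, hx, rfl⟩, ho⟩ := exists_prime_orderOf_dvd_card' p hpc
    rw [← orderOf_coe] at ho
    change orderOf (x : G ⧸ K) = p at ho
    have hxL : x ∈ L := ⟨hx, by
      rw [← QuotientGroup.eq_one_iff, QuotientGroup.mk_pow, ← ho]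
      exact pow_orderOf_eq_one _⟩
    rw [he] at hxL
    rw [(QuotientGroup.eq_one_iff x).2 hxL, orderOf_one] at ho
    exact hp.one_lt.ne ho
  · intro x hx
    rw [← he] at hx
    exact hx.2

end ChiefFactor

section Main

open scoped commutatorElement

variable {G : Type*} [Group G] [Finite G]

theorem IsChiefFactor.le_chiefCentralizer {H K : Subgroup G} (h : IsChiefFactor G H K)
    {p : ℕ} [Fact p.Prime] (hp : ∀ x ∈ H, x ^ p ∈ K) {T : Subgroup G} (hT : T.Normal)
    (hTp : ∀ t ∈ T, ∃ k, t ^ p ^ k ∈ chiefCentralizer G H K h.normalH h.normalK) :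
    T ≤ chiefCentralizer G H K h.normalH h.normalK := by
  have hHn := h.normalH
  have hKn := h.normalK
  let V := H.map (QuotientGroup.mk' K)
  have hV : V.Normal := hHn.map _ (QuotientGroup.mk'_surjective K)
  let f : G →* MulAut V := MulAut.conjNormal.comp (QuotientGroup.mk' K)
  have hf : ∀ c ∈ chiefCentralizer G H K h.normalH h.normalK, f c = 1 := by
    intro c hc
    ext ⟨_, x, hx, rfl⟩
    change (c : G ⧸ K) * x * (c : G ⧸ K)⁻¹ = x
    rw [← mul_inv_eq_one]
    exact (QuotientGroup.eq_one_iff (c * x * c⁻¹ * x⁻¹)).2 (hc x hx)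
  have hPp : IsPGroup p (T.map f) := by
    rintro ⟨_, t, ht, rfl⟩
    obtain ⟨k, hk⟩ := hTp t ht
    exact ⟨k, Subtype.ext ((map_pow f t _).symm.trans (hf _ hk))⟩
  have hVp : IsPGroup p V := by
    rintro ⟨_, x, hx, rfl⟩
    refine ⟨1, Subtype.ext ?_⟩
    rw [pow_one]
    exact (QuotientGroup.eq_one_iff (x ^ p)).2 (hp x hx)
  have hpV : p ∣ Nat.card V := by
    obtain ⟨n, hn⟩ := IsPGroup.iff_card.1 hVp
    rcases n with _ | n
    · rw [pow_zero, card_eq_one, Subgroup.map_eq_bot_iff, QuotientGroup.ker_mk'] at hn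
      exact absurd hn h.lt.not_ge
    · exact hn ▸ dvd_pow_self p n.succ_ne_zero
  obtain ⟨⟨_, x, hx, rfl⟩, hfix, hne⟩ :=
    hPp.exists_fixed_point_of_prime_dvd_card_of_fixed_point V hpV
      (a := (1 : V)) (fun g => map_one (g : MulAut V))
  let L := H ⊓ (centralizer (T.map (QuotientGroup.mk' K) : Set (G ⧸ K))).comap (QuotientGroup.mk' K)
  have hTn : (T.map (QuotientGroup.mk' K)).Normal :=
    hT.map _ (QuotientGroup.mk'_surjective K)
  have hKL : K ≤ L := fun k hk => ⟨h.lt.le hk, by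
    change (k : G ⧸ K) ∈ centralizer (T.map (QuotientGroup.mk' K) : Set (G ⧸ K))
    rw [(QuotientGroup.eq_one_iff k).2 hk]
    exact one_mem _⟩
  rcases h.step L inferInstance hKL inf_le_left with he | he
  · have hxL : x ∈ L := by
      refine ⟨hx, mem_centralizer_iff.2 ?_⟩
      rintro _ ⟨t, ht, rfl⟩
      have := congrArg Subtype.val (hfix ⟨f t, mem_map_of_mem f ht⟩)
      change (t : G ⧸ K) * x * (t : G ⧸ K)⁻¹ = x at this
      exact mul_inv_eq_iff_eq_mul.1 this
    rw [he] at hxL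
    exact absurd (Subtype.ext ((QuotientGroup.eq_one_iff x).2 hxL).symm) hne
  · intro t ht y hy
    rw [← he] at hy
    have := mem_centralizer_iff.1 hy.2 _ (mem_map_of_mem (QuotientGroup.mk' K) ht)
    rw [← QuotientGroup.eq_one_iff]
    change (t : G ⧸ K) * y * (t : G ⧸ K)⁻¹ * (y : G ⧸ K)⁻¹ = 1
    rw [mul_inv_eq_one, mul_inv_eq_iff_eq_mul]
    exact this

theorem IsChiefFactor.isNilpotent_quotient_chiefCentralizer {H K : Subgroup G}
    (h : IsChiefFactor G H K)
    (hHM : ∀ M : Subgroup G, IsMaximalMetanilpotent M → H ≤ M) :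
    letI := chiefCentralizer_normal G H K h.normalH h.normalK
    Group.IsNilpotent (G ⧸ chiefCentralizer G H K h.normalH h.normalK) := by
  have hC := chiefCentralizer_normal G H K h.normalH h.normalK
  obtain ⟨M₀, -, hM₀⟩ := (isMetanilpotent_bot (G := G)).exists_le_isMaximalMetanilpotent
  obtain ⟨p, hp, hHp⟩ := h.exists_prime_pow_mem
    (h.commutator_le (hM₀.1.mono (hHM M₀ hM₀)).isSolvable)
  have : Fact p.Prime := ⟨hp⟩
  refine isNilpotent_of_centralizesNormalizedPSubgroups (p := p) (fun q hq hqp => ?_) ?_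
  · have : Fact q.Prime := ⟨hq⟩
    refine centralizesNormalizedPSubgroups_quotient fun Q hQ y hy hyq u hu x hx => ?_
    obtain ⟨M, hUM, hM⟩ :=
      (isMetanilpotent_sup_zpowers hQ.isNilpotent hy).exists_le_isMaximalMetanilpotent
    obtain ⟨i, hi⟩ := hQ ⟨u, hu⟩
    obtain ⟨j, hj⟩ := hQ ⟨⁅y, u⁆, mul_mem ((mem_normalizer_iff.1 hy u).1 hu) (inv_mem hu)⟩
    exact hM.1.commutator_commutator_mem h.normalH h.normalK (hHM M hM) hp hqp hHp
      (hUM (mem_sup_right (mem_zpowers y))) (hUM (mem_sup_left hu)) hyq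
      (congrArg Subtype.val hi) (congrArg Subtype.val hj) hx
  · intro T hT hTp
    have hle := h.le_chiefCentralizer hHp (hT.comap (QuotientGroup.mk' _)) fun t ht => by
      obtain ⟨k, hk⟩ := hTp ⟨_, ht⟩
      exact ⟨k, (QuotientGroup.eq_one_iff (t ^ p ^ k)).1 (congrArg Subtype.val hk)⟩
    rw [eq_bot_iff]
    intro t ht
    obtain ⟨t, rfl⟩ := QuotientGroup.mk'_surjective _ t
    exact (QuotientGroup.eq_one_iff t).2 (hle ht)

end Main

end

/-- Let `D` be the intersection of all maximal metanilpotent subgroups of a finite group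
`G`.  Then `D` is normal in `G`, `D` is metanilpotent, `G/C_G(H/K)` is nilpotent for every
chief factor `H/K` of `G` below `D`, and `D` contains every normal subgroup `N` of `G`
with these same properties; thus `D` is the largest such normal subgroup of `G`. -/
theorem intersection_maximal_metanilpotent
    (G : Type*) [Group G] [Finite G] (D : Subgroup G)
    (hD : D = ⨅ U ∈ {U : Subgroup G | IsMaximalMetanilpotent U}, U) :
    D.Normal ∧ IsMetanilpotent D ∧
    (∀ H K : Subgroup G, ∀ hcf : IsChiefFactor G H K, H ≤ D →
      letI := chiefCentralizer_normal G H K hcf.normalH hcf.normalK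
      Group.IsNilpotent (G ⧸ chiefCentralizer G H K hcf.normalH hcf.normalK)) ∧
    ∀ N : Subgroup G, N.Normal → IsMetanilpotent N →
      (∀ H K : Subgroup G, ∀ hcf : IsChiefFactor G H K, H ≤ N →
        letI := chiefCentralizer_normal G H K hcf.normalH hcf.normalK
        Group.IsNilpotent (G ⧸ chiefCentralizer G H K hcf.normalH hcf.normalK)) →
      N ≤ D := by
  subst hD
  have hle : ∀ U : Subgroup G, IsMaximalMetanilpotent U →
      (⨅ U ∈ {U : Subgroup G | IsMaximalMetanilpotent U}, U) ≤ U := fun U hU => iInf₂_le U hU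
  obtain ⟨M, -, hM⟩ := (isMetanilpotent_bot (G := G)).exists_le_isMaximalMetanilpotent
  refine ⟨normal_iInf_isMaximalMetanilpotent, hM.1.mono (hle M hM), fun H K hcf hH =>
    hcf.isNilpotent_quotient_chiefCentralizer fun U hU => hH.trans (hle U hU), ?_⟩
  intro N hN _ hcf
  refine le_iInf₂ fun U hU => ?_
  rw [hU.2 (U ⊔ N) le_sup_left (isMetanilpotent_sup hcf hU.1)]
  exact le_sup_right
end

section
/- Let p be a prime and let G be a finite group such that every normal p-subgroup of G is trivial (O_p(G) = 1) and G has exactly one minimal normal subgroup. Then there exists a simple faithful F_p G-module: that is, a nonzero finite-dimensional vector space V over the field with p elements, equipped with an action of G by linear automorphisms, such that V is simple as a module over the group algebra F_p[G] (its only G-invariant subspaces are 0 and V) and the associated homomorphism G → GL(V) is injective. -/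
/-- `N` is a minimal normal subgroup of `G`: `N` is a nontrivial normal subgroup
containing no nontrivial normal subgroup of `G` properly. -/
def IsMinimalNormal {G : Type*} [Group G] (N : Subgroup G) : Prop :=
  N.Normal ∧ N ≠ ⊥ ∧ ∀ M : Subgroup G, M.Normal → M ≠ ⊥ → M ≤ N → M = N

/-- In a finite group with a unique minimal normal subgroup `N`, every nontrivial normal
subgroup contains `N`. -/
theorem IsMinimalNormal.le_of_unique {G : Type*} [Group G] [Finite G] {N : Subgroup G}
    (huniq : ∀ M : Subgroup G, IsMinimalNormal M → M = N)
    (K : Subgroup G) (hK : K.Normal) (hne : K ≠ ⊥) : N ≤ K := by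
  obtain ⟨M, ⟨hMn, hMne, hMK⟩, hmin⟩ := wellFounded_lt.has_min
    {M : Subgroup G | M.Normal ∧ M ≠ ⊥ ∧ M ≤ K} ⟨K, hK, hne, le_rfl⟩
  have hM : IsMinimalNormal M := by
    refine ⟨hMn, hMne, fun L hL hLne hLM => ?_⟩
    by_contra hLM'
    exact hmin L ⟨hL, hLne, hLM.trans hMK⟩ (lt_of_le_of_ne hLM hLM')
  exact huniq M hM ▸ hMK

/-- If the group element `g` acts as the identity on every simple quotient `k[G] ⧸ I`, where `k`
has characteristic `p` and `k[G]` is Artinian, then `g` has `p`-power order. -/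
theorem exists_pow_eq_one_of_forall_smul_eq {k G : Type*} [Field k] [Group G] (p : ℕ)
    [Fact p.Prime] [CharP k p] [IsArtinianRing (MonoidAlgebra k G)] (g : G)
    (h : ∀ I : Ideal (MonoidAlgebra k G), I.IsMaximal →
      ∀ x : MonoidAlgebra k G ⧸ I, MonoidAlgebra.of k G g • x = x) :
    ∃ n : ℕ, g ^ p ^ n = 1 := by
  set a := MonoidAlgebra.of k G g with ha
  have hJ : a - 1 ∈ Ring.jacobson (MonoidAlgebra k G) := by
    refine Submodule.mem_sInf.mpr fun I hI => ?_
    have h1 := h I ⟨hI⟩ (Submodule.Quotient.mk 1)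
    rwa [← Submodule.Quotient.mk_smul, Submodule.Quotient.eq, smul_eq_mul, mul_one] at h1
  obtain ⟨n, hn⟩ := IsSemiprimaryRing.isNilpotent (R := MonoidAlgebra k G)
  have hpow : (a - 1) ^ n = 0 := by
    have := Ideal.pow_mem_pow hJ n
    rw [hn] at this
    exact this
  have : CharP (MonoidAlgebra k G) p := charP_of_injective_algebraMap (algebraMap k _).injective p
  have h1 : a ^ p ^ n = 1 := by
    have h2 : (a - 1) ^ p ^ n = 0 :=
      pow_eq_zero_of_le (Nat.lt_pow_self (Fact.out : p.Prime).one_lt).le hpow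
    rw [sub_pow_char_pow_of_commute _ _ (Commute.one_right a), one_pow] at h2
    exact sub_eq_zero.mp h2
  refine ⟨n, MonoidAlgebra.of_injective (R := k) ?_⟩
  rw [map_pow, map_one, ← ha, h1]

/-- A finite-dimensional simple module over `k[G]` in which only `1 : G` acts trivially yields a
simple faithful representation of `G` on a `k`-vector space in the universe of `k`. -/
theorem exists_simple_faithful_representation {k : Type*} {G M : Type*} [Field k] [Group G]
    [AddCommGroup M] [Module k M] [Module (MonoidAlgebra k G) M]
    [IsScalarTower k (MonoidAlgebra k G) M] [FiniteDimensional k M]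
    [IsSimpleModule (MonoidAlgebra k G) M]
    (hM : ∀ g : G, (∀ x : M, MonoidAlgebra.of k G g • x = x) → g = 1) :
    ∃ (n : ℕ) (ρ : Representation k G (Fin n → k)), Nontrivial (Fin n → k) ∧
      Function.Injective ρ ∧
        ∀ W : Submodule k (Fin n → k), (∀ (g : G) (v : Fin n → k), v ∈ W → ρ g v ∈ W) →
          W = ⊥ ∨ W = ⊤ := by
  let e : M ≃ₗ[k] (Fin (Module.finrank k M) → k) := (Module.finBasis k M).equivFun
  let ρ : Representation k G (Fin (Module.finrank k M) → k) :=
    (e.conjRingEquiv : Module.End k M →* Module.End k _).comp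
      (((Algebra.lsmul k k M : MonoidAlgebra k G →ₐ[k] _) :
        MonoidAlgebra k G →* Module.End k M).comp (MonoidAlgebra.of k G))
  have hρ (g : G) (x : M) : ρ g (e x) = e (MonoidAlgebra.of k G g • x) := by
    simp [ρ, LinearEquiv.conjRingEquiv]
  have : Nontrivial M := IsSimpleModule.nontrivial (MonoidAlgebra k G) M
  refine ⟨_, ρ, e.symm.toEquiv.nontrivial, ?_, fun W hW => ?_⟩
  · rw [injective_iff_map_eq_one]
    intro g hg
    refine hM g fun x => e.injective ?_
    rw [← hρ, hg, Module.End.one_apply]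
  · let W' : Submodule (MonoidAlgebra k G) M :=
      { carrier := {x | e x ∈ W}
        add_mem' := fun {x y} hx hy => by
          simpa only [Set.mem_ofPred_eq, map_add] using W.add_mem hx hy
        zero_mem' := by simp
        smul_mem' := fun a x hx => by
          induction a using MonoidAlgebra.induction_on with
          | of g =>
            simp only [Set.mem_ofPred_eq, ← hρ]
            exact hW g _ hx
          | add a b ha hb =>
            simpa only [Set.mem_ofPred_eq, add_smul, map_add] using W.add_mem ha hb
          | smul r a ha =>
            simpa only [Set.mem_ofPred_eq, smul_assoc, map_smul] using W.smul_mem r ha }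
    have hmem (x : M) : x ∈ W' ↔ e x ∈ W := Iff.rfl
    refine (eq_bot_or_eq_top W').imp (fun h => ?_) fun h => ?_
    · refine (Submodule.eq_bot_iff W).mpr fun v hv => ?_
      have := (hmem (e.symm v)).mpr (by simpa using hv)
      simpa [h] using this
    · refine Submodule.eq_top_iff'.mpr fun v => ?_
      have := (hmem (e.symm v)).mp (h ▸ Submodule.mem_top)
      simpa using this

/-- Let `p` be a prime and `G` a finite group with `O_p(G) = 1` (every normal `p`-subgroup
is trivial) having exactly one minimal normal subgroup.  Then there exists a simple
faithful `𝔽_p G`-module: a nonzero finite-dimensional vector space `V` over `𝔽_p = ZMod p`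
together with a representation `ρ` of `G` on `V` which is injective (faithful) and such
that the only `G`-invariant submodules of `V` are `⊥` and `⊤` (simplicity). -/
theorem exists_simple_faithful_modp_module
    (p : ℕ) [Fact p.Prime] (G : Type*) [Group G] [Finite G]
    (hOp : ∀ N : Subgroup G, N.Normal → IsPGroup p N → N = ⊥)
    (huniq : ∃! N : Subgroup G, IsMinimalNormal N) :
    ∃ (V : Type) (_ : AddCommGroup V) (_ : Module (ZMod p) V),
      Nontrivial V ∧ FiniteDimensional (ZMod p) V ∧
      ∃ ρ : Representation (ZMod p) G V,
        Function.Injective ρ ∧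
        ∀ W : Submodule (ZMod p) V, (∀ (g : G) (v : V), v ∈ W → ρ g v ∈ W) →
          W = ⊥ ∨ W = ⊤ := by
  obtain ⟨N, hN, hNuniq⟩ := huniq
  have : Module.Finite (ZMod p) (MonoidAlgebra (ZMod p) G) := inferInstance
  have : IsArtinianRing (MonoidAlgebra (ZMod p) G) :=
    isArtinian_of_tower (ZMod p) inferInstance
  obtain ⟨I, hI, hIfaithful⟩ : ∃ I : Ideal (MonoidAlgebra (ZMod p) G), I.IsMaximal ∧
      ∀ g : G, (∀ x : MonoidAlgebra (ZMod p) G ⧸ I, MonoidAlgebra.of (ZMod p) G g • x = x) →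
        g = 1 := by
    by_contra! hcon
    refine hN.2.1 (hOp N hN.1 fun g => ?_)
    obtain ⟨n, hn⟩ := exists_pow_eq_one_of_forall_smul_eq (k := ZMod p) p (g : G) fun I hI => by
      let φ := (Module.toAddMonoidEnd (MonoidAlgebra (ZMod p) G)
        (MonoidAlgebra (ZMod p) G ⧸ I)).toMonoidHom.comp (MonoidAlgebra.of (ZMod p) G)
      obtain ⟨h, hh, hne⟩ := hcon I hI
      have hle : N ≤ φ.ker := IsMinimalNormal.le_of_unique hNuniq φ.ker inferInstance fun hbot =>
        hne ((Subgroup.eq_bot_iff_forall _).mp hbot h (AddMonoidHom.ext hh))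
      exact DFunLike.congr_fun (MonoidHom.mem_ker.mp (hle g.2))
    exact ⟨n, Subtype.ext (by simpa using hn)⟩
  have : IsSimpleModule (MonoidAlgebra (ZMod p) G) (MonoidAlgebra (ZMod p) G ⧸ I) :=
    isSimpleModule_iff_isCoatom.mpr hI.out
  obtain ⟨n, ρ, hV, hinj, hsimple⟩ := exists_simple_faithful_representation hIfaithful
  exact ⟨Fin n → ZMod p, inferInstance, inferInstance, hV, inferInstance, ρ, hinj, hsimple⟩
end
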